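/- If 0 < α < α_th, then lim_{A→∞} ( C_{h,σ²}(A, αA) − log A ) = (1/2)·log( s_n²/(2π e σ²) ) + sup over λ ∈ (max{0, 1/2 + α − α_th}, min{1/2, α}) of { 1 − log( μ(λ)/(1 − e^{−μ(λ)}) ) − μ(λ) e^{−μ(λ)}/(1 − e^{−μ(λ)}) − ∑_{k=1}^n p_k log( p_k s_n / h_k ) }, where p_k = h_k a^k / ∑_{j=1}^n h_j a^j with a the unique positive solution of ( ∑_{k=1}^n h_k k a^k ) / ( ∑_{j=1}^n h_j a^j ) = α − λ + 1. -/

import Mathlib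

open MeasureTheory ProbabilityTheory Real Filter
open scoped NNReal ENNReal Classical

noncomputable section

/-- Kullback–Leibler divergence (Mathlib's `ProbabilityTheory.klDiv`). -/
def klDiv {α : Type*} [MeasurableSpace α] (μ ν : Measure α) : EReal :=
  if μ ≪ ν ∧ Integrable (llr μ ν) μ then ((∫ x, llr μ ν x ∂μ : ℝ) : EReal) else ⊤

/-- Mutual information of a joint law: KL divergence of the joint law from the
product of its marginals. -/
def mutualInfo {α β : Type*} [MeasurableSpace α] [MeasurableSpace β]
    (joint : Measure (α × β)) : EReal :=
  klDiv joint ((joint.map Prod.fst).prod (joint.map Prod.snd))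

/-- Partial sums `s_k = h_1 + ⋯ + h_k`. -/
def sCum {n : ℕ} (h : Fin n → ℝ) (k : ℕ) : ℝ :=
  ∑ i : Fin n, if i.val < k then h i else 0

/-- Joint law of `(X, Y)` with `Y = hᵀX + Z`, `Z ~ N(0, v)` independent of `X`. -/
def misoJoint {n : ℕ} (h : Fin n → ℝ) (v : ℝ≥0) (μ : Measure (Fin n → ℝ)) :
    Measure ((Fin n → ℝ) × ℝ) :=
  (μ.prod (gaussianReal 0 v)).map (fun p => (p.1, (∑ k, h k * p.1 k) + p.2))

/-- MISO capacity under peak-power constraint `A` and average-power constraint `E`. -/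
def misoCapacity {n : ℕ} (h : Fin n → ℝ) (v : ℝ≥0) (A E : ℝ) : EReal :=
  ⨆ μ ∈ {μ : Measure (Fin n → ℝ) | IsProbabilityMeasure μ ∧
      (∀ k, ∀ᵐ x ∂μ, x k ∈ Set.Icc 0 A) ∧ (∑ k, ∫ x, x k ∂μ) ≤ E},
    mutualInfo (misoJoint h v μ)

/-- MISO capacity under only an average-power constraint `E`. -/
def misoCapacityAvg {n : ℕ} (h : Fin n → ℝ) (v : ℝ≥0) (E : ℝ) : EReal :=
  ⨆ μ ∈ {μ : Measure (Fin n → ℝ) | IsProbabilityMeasure μ ∧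
      (∀ k, ∀ᵐ x ∂μ, 0 ≤ x k) ∧ (∑ k, ∫ x, x k ∂μ) ≤ E},
    mutualInfo (misoJoint h v μ)

/-- Joint law of `(X̄, X̄ + Z)` for the unit-gain SISO channel. -/
def sisoJoint (v : ℝ≥0) (μ : Measure ℝ) : Measure (ℝ × ℝ) :=
  (μ.prod (gaussianReal 0 v)).map (fun p => (p.1, p.1 + p.2))

/-- Unit-gain SISO capacity under peak-power constraint `A` and average-power
constraint `E`. -/
def sisoCapacity (v : ℝ≥0) (A E : ℝ) : EReal :=
  ⨆ μ ∈ {μ : Measure ℝ | IsProbabilityMeasure μ ∧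
      (∀ᵐ x ∂μ, x ∈ Set.Icc 0 A) ∧ (∫ x, x ∂μ) ≤ E},
    mutualInfo (sisoJoint v μ)

/-- Unit-gain SISO capacity under only an average-power constraint `E`. -/
def sisoCapacityAvg (v : ℝ≥0) (E : ℝ) : EReal :=
  ⨆ μ ∈ {μ : Measure ℝ | IsProbabilityMeasure μ ∧
      (∀ᵐ x ∂μ, 0 ≤ x) ∧ (∫ x, x ∂μ) ≤ E},
    mutualInfo (sisoJoint v μ)

/-- The interval `(s_{k-1} A, s_k A]` (with the first one being `[0, s_1 A]`)
corresponding to the event `U = k` (0-indexed: `k ∈ Fin n` stands for `k+1`). -/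
def uInterval {n : ℕ} (h : Fin n → ℝ) (A : ℝ) (k : Fin n) : Set ℝ :=
  if k.val = 0 then Set.Icc 0 (sCum h 1 * A)
  else Set.Ioc (sCum h k.val * A) (sCum h (k.val + 1) * A)

/-- The average input power `∑_k p_k ((E[X̄ | U=k] - A s_{k-1})/h_k + (k-1) A)`
consumed to generate a scalar law of `X̄`. -/
def avgPowerUse {n : ℕ} (h : Fin n → ℝ) (A : ℝ) (μ : Measure ℝ) : ℝ :=
  ∑ k : Fin n,
    (((∫ x in uInterval h A k, x ∂μ) - A * sCum h k.val * (μ (uInterval h A k)).toReal) / h k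
      + (k.val : ℝ) * A * (μ (uInterval h A k)).toReal)

/-- The threshold `α_th`. -/
def alphaTh {n : ℕ} (h : Fin n → ℝ) : ℝ :=
  1 / 2 + (1 / sCum h n) * ∑ k : Fin n, h k * (k.val : ℝ)


end


/-- The density of `u X + Z` for `X ∼ P` and an independent centred Gaussian `Z` of variance `v`. -/
noncomputable def outputDensity {E : Type*} [MeasurableSpace E] (P : Measure E) (u : E → ℝ)
    (v : ℝ≥0) (y : ℝ) : ℝ :=
  ∫ x, gaussianPDFReal 0 v (y - u x) ∂P

theorem gaussianPDFReal_zero_mean_le (v : ℝ≥0) (x : ℝ) :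
    gaussianPDFReal 0 v x ≤ (√(2 * π * v))⁻¹ := by
  rw [gaussianPDFReal]
  refine mul_le_of_le_one_right (by positivity) ?_
  rw [Real.exp_le_one_iff]
  exact div_nonpos_of_nonpos_of_nonneg (by nlinarith [sq_nonneg (x - 0)]) (by positivity)

theorem log_gaussianPDFReal_zero_mean {v : ℝ≥0} (hv : 0 < v) (x : ℝ) :
    Real.log (gaussianPDFReal 0 v x) = Real.log (√(2 * π * v))⁻¹ - x ^ 2 / (2 * v) := by
  have hv' : (0 : ℝ) < v := hv
  rw [gaussianPDFReal, Real.log_mul (by positivity) (Real.exp_pos _).ne', Real.log_exp]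
  ring

theorem lintegral_prod_gaussianReal_shear {E : Type*} [MeasurableSpace E] {P : Measure E}
    {u : E → ℝ} {v : ℝ≥0} (hu : Measurable u) (hv : 0 < v)
    {F : E × ℝ → ℝ≥0∞} (hF : Measurable F) :
    ∫⁻ p, F (p.1, u p.1 + p.2) ∂(P.prod (gaussianReal 0 v)) =
      ∫⁻ x, (∫⁻ y, gaussianPDF 0 v (y - u x) * F (x, y)) ∂P := by
  have hF' : Measurable fun p : E × ℝ => F (p.1, u p.1 + p.2) := hF.comp (by fun_prop)
  rw [lintegral_prod _ hF'.aemeasurable]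
  refine lintegral_congr fun x => ?_
  have hFx : Measurable fun z => F (x, u x + z) := hF'.comp measurable_prodMk_left
  rw [gaussianReal_of_var_ne_zero 0 hv.ne', lintegral_withDensity_eq_lintegral_mul _
    (measurable_gaussianPDF 0 v) hFx,
    ← lintegral_sub_right_eq_self _ (u x)]
  simp

section Output

variable {E : Type*} [MeasurableSpace E] {P : Measure E} [IsProbabilityMeasure P] {u : E → ℝ}
  {v : ℝ≥0}

theorem integrable_gaussianPDFReal_sub (hu : Measurable u) (y : ℝ) :
    Integrable (fun x => gaussianPDFReal 0 v (y - u x)) P := by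
  refine Integrable.of_bound (C := (√(2 * π * v))⁻¹)
    ((measurable_gaussianPDFReal 0 v).comp (by fun_prop)).aestronglyMeasurable ?_
  refine Eventually.of_forall fun x => ?_
  rw [Real.norm_of_nonneg (gaussianPDFReal_nonneg _ _ _)]
  exact gaussianPDFReal_zero_mean_le v _

theorem measurable_outputDensity (hu : Measurable u) : Measurable (outputDensity P u v) := by
  have : StronglyMeasurable (fun q : ℝ × E => gaussianPDFReal 0 v (q.1 - u q.2)) :=
    ((measurable_gaussianPDFReal 0 v).comp (by fun_prop)).stronglyMeasurable
  exact this.integral_prod_right.measurable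

theorem outputDensity_pos (hu : Measurable u) (hv : 0 < v) (y : ℝ) :
    0 < outputDensity P u v y := by
  rw [outputDensity, integral_pos_iff_support_of_nonneg
    (fun x => gaussianPDFReal_nonneg _ _ _) (integrable_gaussianPDFReal_sub hu y)]
  have : Function.support (fun x => gaussianPDFReal 0 v (y - u x)) = Set.univ :=
    Set.eq_univ_of_forall fun x => (gaussianPDFReal_pos 0 v _ hv.ne').ne'
  rw [this]
  simp

theorem outputDensity_le (hu : Measurable u) (y : ℝ) :
    outputDensity P u v y ≤ (√(2 * π * v))⁻¹ := by
  calc outputDensity P u v y ≤ ∫ _, (√(2 * π * v))⁻¹ ∂P :=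
        integral_mono (integrable_gaussianPDFReal_sub hu y) (integrable_const _)
          fun x => gaussianPDFReal_zero_mean_le v _
    _ = _ := by simp

theorem le_outputDensity (hu : Measurable u) {B : ℝ} (hB : ∀ᵐ x ∂P, |u x| ≤ B) (y : ℝ) :
    (√(2 * π * v))⁻¹ * Real.exp (-(|y| + B) ^ 2 / (2 * v)) ≤ outputDensity P u v y := by
  calc _ = ∫ _, (√(2 * π * v))⁻¹ * Real.exp (-(|y| + B) ^ 2 / (2 * v)) ∂P := by simp
    _ ≤ outputDensity P u v y := by
      refine integral_mono_ae (integrable_const _) (integrable_gaussianPDFReal_sub hu y) ?_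
      filter_upwards [hB] with x hx
      rw [gaussianPDFReal]
      have h1 : |y - u x| ≤ |y| + B := (abs_sub _ _).trans (by linarith)
      have h2 : (y - u x) ^ 2 ≤ (|y| + B) ^ 2 := by
        rw [← sq_abs (y - u x)]
        gcongr
      simp only [sub_zero]
      gcongr

theorem ofReal_outputDensity (hu : Measurable u) (y : ℝ) :
    ENNReal.ofReal (outputDensity P u v y) = ∫⁻ x, gaussianPDF 0 v (y - u x) ∂P :=
  ofReal_integral_eq_lintegral_ofReal (integrable_gaussianPDFReal_sub hu y)
    (Eventually.of_forall fun _ => gaussianPDFReal_nonneg _ _ _)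

theorem map_shear_eq_withDensity (hu : Measurable u) (hv : 0 < v) :
    (P.prod (gaussianReal 0 v)).map (fun p => u p.1 + p.2) =
      (volume : Measure ℝ).withDensity (fun y => ENNReal.ofReal (outputDensity P u v y)) := by
  have hpdf := measurable_gaussianPDF 0 v
  ext s hs
  rw [← lintegral_indicator_one hs, lintegral_map (measurable_one.indicator hs) (by fun_prop),
    withDensity_apply _ hs, ← lintegral_indicator hs]
  have := lintegral_prod_gaussianReal_shear (P := P) hu hv (F := fun p => s.indicator 1 p.2)
    ((measurable_one.indicator hs).comp measurable_snd)
  simp only at this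
  rw [this, lintegral_lintegral_swap]
  · refine lintegral_congr fun y => ?_
    by_cases hy : y ∈ s
    · simp [hy, ofReal_outputDensity hu]
    · simp [hy]
  · refine Measurable.aemeasurable (Measurable.mul (hpdf.comp (by fun_prop)) ?_)
    exact (measurable_one.indicator hs).comp measurable_snd

theorem map_shear_eq_withDensity_prod (hu : Measurable u) (hv : 0 < v) :
    (P.prod (gaussianReal 0 v)).map (fun p => (p.1, u p.1 + p.2)) =
      (P.prod ((P.prod (gaussianReal 0 v)).map (fun p => u p.1 + p.2))).withDensity
        (fun p => ENNReal.ofReal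
          (gaussianPDFReal 0 v (p.2 - u p.1) / outputDensity P u v p.2)) := by
  have hd := measurable_outputDensity (P := P) (v := v) hu
  have hpdf := measurable_gaussianPDF 0 v
  have hpr := measurable_gaussianPDFReal 0 v
  have hm : Measurable fun p : E × ℝ => ENNReal.ofReal
      (gaussianPDFReal 0 v (p.2 - u p.1) / outputDensity P u v p.2) :=
    ((hpr.comp (by fun_prop)).div (hd.comp measurable_snd)).ennreal_ofReal
  ext s hs
  rw [← lintegral_indicator_one hs, lintegral_map (measurable_one.indicator hs) (by fun_prop),
    lintegral_prod_gaussianReal_shear hu hv (measurable_one.indicator hs),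
    withDensity_apply _ hs, ← lintegral_indicator hs, map_shear_eq_withDensity hu hv,
    lintegral_prod _ (hm.indicator hs).aemeasurable]
  refine lintegral_congr fun x => ?_
  have hmx : Measurable fun y => s.indicator (fun p : E × ℝ => ENNReal.ofReal
      (gaussianPDFReal 0 v (p.2 - u p.1) / outputDensity P u v p.2)) (x, y) :=
    (hm.indicator hs).comp measurable_prodMk_left
  rw [lintegral_withDensity_eq_lintegral_mul _ hd.ennreal_ofReal hmx]
  refine lintegral_congr fun y => ?_
  by_cases hy : (x, y) ∈ s
  · simp only [hy, Set.indicator_of_mem, Pi.one_apply, mul_one, Pi.mul_apply]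
    rw [← ENNReal.ofReal_mul (outputDensity_pos hu hv y).le,
      mul_div_cancel₀ _ (outputDensity_pos hu hv y).ne', gaussianPDF]
  · simp [hy]

theorem integrable_log_outputDensity (hu : Measurable u) (hv : 0 < v) {B : ℝ}
    (hB : ∀ᵐ x ∂P, |u x| ≤ B) :
    Integrable (fun p : E × ℝ => Real.log (outputDensity P u v (u p.1 + p.2)))
      (P.prod (gaussianReal 0 v)) := by
  have hv' : (0 : ℝ) < v := hv
  set c := (√(2 * π * v))⁻¹ with hc
  have hcpos : 0 < c := by positivity
  have hsq : Integrable (fun z : ℝ => z ^ 2) (gaussianReal 0 v) :=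
    (memLp_id_gaussianReal' 2 (by simp)).integrable_sq
  have hdom : Integrable (fun p : E × ℝ => |Real.log c| + (2 * p.2 ^ 2 + 8 * B ^ 2) / (2 * v))
      (P.prod (gaussianReal 0 v)) :=
    (integrable_const _).add
      ((((hsq.const_mul 2).add (integrable_const (8 * B ^ 2))).div_const _).comp_snd P)
  have hd := measurable_outputDensity (P := P) (v := v) hu
  refine hdom.mono' (Measurable.aestronglyMeasurable (by fun_prop)) ?_
  have hB' : ∀ᵐ p ∂(P.prod (gaussianReal 0 v)), |u p.1| ≤ B :=
    Measure.quasiMeasurePreserving_fst.ae hB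
  filter_upwards [hB'] with p hp
  have h1 : Real.log (outputDensity P u v (u p.1 + p.2)) ≤ Real.log c :=
    Real.log_le_log (outputDensity_pos hu hv _) (outputDensity_le hu _)
  have h2 := Real.log_le_log (by positivity) (le_outputDensity (v := v) hu hB (u p.1 + p.2))
  rw [Real.log_mul hcpos.ne' (Real.exp_pos _).ne', Real.log_exp] at h2
  have h3 : (|u p.1 + p.2| + B) ^ 2 ≤ 2 * p.2 ^ 2 + 8 * B ^ 2 := by
    have h0 : |u p.1 + p.2| + B ≤ |p.2| + 2 * B := by
      linarith [abs_add_le (u p.1) p.2]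
    have hB0 : 0 ≤ B := (abs_nonneg _).trans hp
    calc (|u p.1 + p.2| + B) ^ 2 ≤ (|p.2| + 2 * B) ^ 2 := by gcongr
      _ ≤ 2 * |p.2| ^ 2 + 8 * B ^ 2 := by nlinarith [sq_nonneg (|p.2| - 2 * B)]
      _ = _ := by rw [sq_abs]
  have h4 : (|u p.1 + p.2| + B) ^ 2 / (2 * v) ≤ (2 * p.2 ^ 2 + 8 * B ^ 2) / (2 * v) := by gcongr
  have h5 : 0 ≤ (2 * p.2 ^ 2 + 8 * B ^ 2) / (2 * (v : ℝ)) := by positivity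
  rw [Real.norm_eq_abs, abs_le]
  rw [neg_div] at h2
  constructor
  · linarith [neg_abs_le (Real.log c)]
  · linarith [le_abs_self (Real.log c)]

theorem integrable_log_gaussianPDFReal (hv : 0 < v) :
    Integrable (fun z => Real.log (gaussianPDFReal 0 v z)) (gaussianReal 0 v) := by
  simp_rw [log_gaussianPDFReal_zero_mean hv]
  have hsq : Integrable (fun z : ℝ => z ^ 2) (gaussianReal 0 v) :=
    (memLp_id_gaussianReal' 2 (by simp)).integrable_sq
  exact (integrable_const _).sub (hsq.div_const _)

theorem integral_log_gaussianPDFReal (hv : 0 < v) :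
    ∫ z, Real.log (gaussianPDFReal 0 v z) ∂(gaussianReal 0 v) =
      -(1 / 2 * Real.log (2 * π * Real.exp 1 * v)) := by
  have hv' : (0 : ℝ) < v := hv
  simp_rw [log_gaussianPDFReal_zero_mean hv]
  have hsq : Integrable (fun z : ℝ => z ^ 2) (gaussianReal 0 v) :=
    (memLp_id_gaussianReal' 2 (by simp)).integrable_sq
  have hvar : ∫ z, z ^ 2 ∂(gaussianReal 0 v) = v := by
    have := variance_fun_id_gaussianReal (μ := 0) (v := v)
    rw [variance_eq_integral (by fun_prop), integral_id_gaussianReal] at this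
    simpa using this
  rw [integral_sub (integrable_const _) (hsq.div_const _), integral_div, hvar,
    show 2 * π * Real.exp 1 * (v : ℝ) = (2 * π * v) * Real.exp 1 by ring,
    Real.log_mul (by positivity) (Real.exp_pos _).ne', Real.log_exp, Real.log_inv,
    Real.log_sqrt (by positivity)]
  simp only [integral_const, probReal_univ, one_smul]
  field_simp
  ring

theorem mutualInfo_shear (hu : Measurable u) (hv : 0 < v) {B : ℝ} (hB : ∀ᵐ x ∂P, |u x| ≤ B) :
    mutualInfo ((P.prod (gaussianReal 0 v)).map (fun p => (p.1, u p.1 + p.2))) =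
      ((-(1 / 2 * Real.log (2 * π * Real.exp 1 * v)) -
        ∫ p, Real.log (outputDensity P u v (u p.1 + p.2)) ∂(P.prod (gaussianReal 0 v)) : ℝ) :
        EReal) := by
  have hmeas : Measurable fun p : E × ℝ => (p.1, u p.1 + p.2) := by fun_prop
  have hfst : ((P.prod (gaussianReal 0 v)).map (fun p => (p.1, u p.1 + p.2))).map Prod.fst = P := by
    rw [Measure.map_map measurable_fst hmeas]
    exact measurePreserving_fst.map_eq
  have hsnd : ((P.prod (gaussianReal 0 v)).map (fun p => (p.1, u p.1 + p.2))).map Prod.snd =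
      (P.prod (gaussianReal 0 v)).map (fun p => u p.1 + p.2) := by
    rw [Measure.map_map measurable_snd hmeas]
    rfl
  rw [mutualInfo, hfst, hsnd, klDiv]
  have hJ := map_shear_eq_withDensity_prod (P := P) hu hv
  have hPY : IsProbabilityMeasure ((P.prod (gaussianReal 0 v)).map (fun p => u p.1 + p.2)) :=
    Measure.isProbabilityMeasure_map (by fun_prop)
  set Q := P.prod ((P.prod (gaussianReal 0 v)).map (fun p => u p.1 + p.2)) with hQ
  have hd := measurable_outputDensity (P := P) (v := v) hu
  have hpr := measurable_gaussianPDFReal 0 v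
  have hac : (P.prod (gaussianReal 0 v)).map (fun p => (p.1, u p.1 + p.2)) ≪ Q := by
    rw [hJ]
    exact withDensity_absolutelyContinuous _ _
  have hllr : llr ((P.prod (gaussianReal 0 v)).map (fun p => (p.1, u p.1 + p.2))) Q
      =ᵐ[(P.prod (gaussianReal 0 v)).map (fun p => (p.1, u p.1 + p.2))]
      fun p => Real.log (gaussianPDFReal 0 v (p.2 - u p.1)) -
        Real.log (outputDensity P u v p.2) := by
    refine hac.ae_eq ?_
    have hm : Measurable fun p : E × ℝ => ENNReal.ofReal
        (gaussianPDFReal 0 v (p.2 - u p.1) / outputDensity P u v p.2) :=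
      ((hpr.comp (by fun_prop)).div (hd.comp measurable_snd)).ennreal_ofReal
    filter_upwards [Measure.rnDeriv_withDensity Q hm] with p hp
    rw [llr, hJ, hp, ENNReal.toReal_ofReal (div_nonneg (gaussianPDFReal_nonneg _ _ _)
      (outputDensity_pos hu hv _).le), Real.log_div (gaussianPDFReal_pos _ _ _ hv.ne').ne'
      (outputDensity_pos hu hv _).ne']
  have hlm : Measurable fun p : E × ℝ => Real.log (gaussianPDFReal 0 v (p.2 - u p.1)) -
        Real.log (outputDensity P u v p.2) :=
    (Real.measurable_log.comp (hpr.comp (by fun_prop))).sub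
      (Real.measurable_log.comp (hd.comp measurable_snd))
  have h1 : Integrable (fun p : E × ℝ => Real.log (gaussianPDFReal 0 v p.2))
      (P.prod (gaussianReal 0 v)) := (integrable_log_gaussianPDFReal hv).comp_snd P
  have h2 := integrable_log_outputDensity (P := P) hu hv hB
  have hint : Integrable
      (llr ((P.prod (gaussianReal 0 v)).map (fun p => (p.1, u p.1 + p.2))) Q)
      ((P.prod (gaussianReal 0 v)).map (fun p => (p.1, u p.1 + p.2))) := by
    rw [integrable_congr hllr, integrable_map_measure hlm.aestronglyMeasurable hmeas.aemeasurable]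
    simp only [Function.comp_def, add_sub_cancel_left]
    exact h1.sub h2
  rw [if_pos ⟨hac, hint⟩, integral_congr_ae hllr,
    integral_map hmeas.aemeasurable hlm.aestronglyMeasurable]
  simp only [add_sub_cancel_left]
  rw [integral_sub h1 h2, ← integral_log_gaussianPDFReal hv]
  congr 3
  have := integral_prod_mul (μ := P) (ν := gaussianReal 0 v) (fun _ => (1 : ℝ))
    (fun z => Real.log (gaussianPDFReal 0 v z))
  simpa using this

/-- Gibbs' inequality: the mutual information is at most the cross entropy with respect to the
density proportional to `exp (-r)`. -/
theorem neg_integral_log_outputDensity_le (hu : Measurable u) (hv : 0 < v) {B : ℝ}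
    (hB : ∀ᵐ x ∂P, |u x| ≤ B) {r : ℝ → ℝ} (hr : Measurable r)
    (hri : Integrable (fun p : E × ℝ => r (u p.1 + p.2)) (P.prod (gaussianReal 0 v)))
    (hexp : Integrable (fun y => Real.exp (-r y))) {C : ℝ} (hC : 0 < C)
    (hCle : ∫ y, Real.exp (-r y) ≤ C) :
    -∫ p, Real.log (outputDensity P u v (u p.1 + p.2)) ∂(P.prod (gaussianReal 0 v)) ≤
      ∫ p, r (u p.1 + p.2) ∂(P.prod (gaussianReal 0 v)) + Real.log C := by
  have hd := measurable_outputDensity (P := P) (v := v) hu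
  have hpos := outputDensity_pos (P := P) hu hv
  set w : ℝ → ℝ := fun y => Real.exp (-r y) / (C * outputDensity P u v y) with hw
  have hwm : Measurable w := by fun_prop
  have hfw : ∀ y, outputDensity P u v y * w y = Real.exp (-r y) / C := fun y => by
    have := (hpos y).ne'
    rw [hw]
    field_simp
  have hmap := map_shear_eq_withDensity (P := P) hu hv
  have hwi : Integrable w ((P.prod (gaussianReal 0 v)).map (fun p => u p.1 + p.2)) := by
    rw [hmap, integrable_withDensity_iff_integrable_smul₀' hd.ennreal_ofReal.aemeasurable
      (by simp)]
    simp_rw [ENNReal.toReal_ofReal (hpos _).le, smul_eq_mul, hfw]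
    exact hexp.div_const _
  have hwint : ∫ y, w y ∂((P.prod (gaussianReal 0 v)).map (fun p => u p.1 + p.2)) ≤ 1 := by
    rw [hmap, integral_withDensity_eq_integral_toReal_smul hd.ennreal_ofReal (by simp)]
    simp_rw [ENNReal.toReal_ofReal (hpos _).le, smul_eq_mul, hfw]
    rw [integral_div]
    exact (div_le_one hC).2 hCle
  have hwi' : Integrable (fun p : E × ℝ => w (u p.1 + p.2)) (P.prod (gaussianReal 0 v)) :=
    (integrable_map_measure hwm.aestronglyMeasurable (by fun_prop)).1 hwi
  rw [integral_map (by fun_prop) hwm.aestronglyMeasurable] at hwint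
  have hpt : ∀ y, -Real.log (outputDensity P u v y) ≤ r y + Real.log C + (w y - 1) := fun y => by
    have h1 : 0 < w y := div_pos (Real.exp_pos _) (mul_pos hC (hpos y))
    have h2 := Real.log_le_sub_one_of_pos h1
    rw [hw, Real.log_div (Real.exp_pos _).ne' (mul_pos hC (hpos y)).ne',
      Real.log_mul hC.ne' (hpos y).ne', Real.log_exp] at h2
    linarith
  rw [← integral_neg]
  have hrc := hri.add (integrable_const (Real.log C))
  have hw1 : Integrable (fun p : E × ℝ => w (u p.1 + p.2) - 1) (P.prod (gaussianReal 0 v)) :=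
    hwi'.sub (integrable_const (1 : ℝ))
  have hmono : ∫ p, -Real.log (outputDensity P u v (u p.1 + p.2)) ∂(P.prod (gaussianReal 0 v)) ≤
      ∫ p, (r (u p.1 + p.2) + Real.log C + (w (u p.1 + p.2) - 1)) ∂(P.prod (gaussianReal 0 v)) :=
    integral_mono (integrable_log_outputDensity hu hv hB).neg (hrc.add hw1) fun p => hpt _
  rw [integral_add (f := fun p : E × ℝ => r (u p.1 + p.2) + Real.log C) hrc hw1,
    integral_add hri (integrable_const _), integral_sub hwi' (integrable_const _)] at hmono
  simp only [integral_const, probReal_univ, one_smul] at hmono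
  linarith

theorem le_neg_integral_log_outputDensity (hu : Measurable u) (hv : 0 < v) {B : ℝ}
    (hB : ∀ᵐ x ∂P, |u x| ≤ B) {r : ℝ → ℝ}
    (hri : Integrable (fun p : E × ℝ => r (u p.1 + p.2)) (P.prod (gaussianReal 0 v)))
    {C : ℝ} (hC : 0 < C) (hle : ∀ y, outputDensity P u v y ≤ C * Real.exp (-r y)) :
    ∫ p, r (u p.1 + p.2) ∂(P.prod (gaussianReal 0 v)) - Real.log C ≤
      -∫ p, Real.log (outputDensity P u v (u p.1 + p.2)) ∂(P.prod (gaussianReal 0 v)) := by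
  have hrc := hri.sub (integrable_const (Real.log C))
  have hmono : ∫ p, (r (u p.1 + p.2) - Real.log C) ∂(P.prod (gaussianReal 0 v)) ≤
      ∫ p, -Real.log (outputDensity P u v (u p.1 + p.2)) ∂(P.prod (gaussianReal 0 v)) := by
    refine integral_mono hrc (integrable_log_outputDensity hu hv hB).neg fun p => ?_
    have h1 := Real.log_le_log (outputDensity_pos hu hv _) (hle (u p.1 + p.2))
    rw [Real.log_mul hC.ne' (Real.exp_pos _).ne', Real.log_exp] at h1
    linarith
  rw [integral_sub hri (integrable_const _), integral_neg] at hmono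
  simpa using hmono

end Output

theorem sCum_zero {n : ℕ} (h : Fin n → ℝ) : sCum h 0 = 0 := by simp [sCum]

theorem sCum_succ {n : ℕ} (h : Fin n → ℝ) (k : Fin n) :
    sCum h (k.val + 1) = sCum h k.val + h k := by
  have : h k = ∑ i : Fin n, if i = k then h i else 0 := by simp
  rw [sCum, sCum, this, ← Finset.sum_add_distrib]
  refine Finset.sum_congr rfl fun i _ => ?_
  rcases lt_trichotomy i.val k.val with hi | hi | hi
  · simp [hi, Nat.lt_succ_of_lt hi, Fin.ext_iff, hi.ne]
  · simp [hi, Fin.ext_iff]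
  · simp [Fin.ext_iff, hi.ne', not_lt.2 hi.le, not_lt.2 (Nat.succ_le_of_lt hi)]

theorem sCum_self {n : ℕ} (h : Fin n → ℝ) : sCum h n = ∑ i, h i := by simp [sCum]

theorem sCum_mono {n : ℕ} {h : Fin n → ℝ} (hpos : ∀ k, 0 < h k) {a b : ℕ} (hab : a ≤ b) :
    sCum h a ≤ sCum h b := by
  refine Finset.sum_le_sum fun i _ => ?_
  by_cases hi : i.val < a
  · simp [hi, hi.trans_le hab]
  · by_cases hb : i.val < b
    · simp [hi, hb, (hpos i).le]
    · simp [hi, hb]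

theorem exists_eq_sCum_add {n : ℕ} {h : Fin n → ℝ} (hpos : ∀ k, 0 < h k) {s : ℝ} (hs0 : 0 < s)
    (hs : s ≤ sCum h n) :
    ∃ k : Fin n, ∃ t ∈ Set.Icc (0 : ℝ) 1, s = sCum h k.val + h k * t := by
  have key : ∀ m ≤ n, s ≤ sCum h m →
      ∃ k : Fin n, ∃ t ∈ Set.Icc (0 : ℝ) 1, s = sCum h k.val + h k * t := by
    intro m
    induction m with
    | zero => intro _ h0; rw [sCum_zero] at h0; linarith
    | succ m ih =>
      intro hm hsm
      by_cases hle : s ≤ sCum h m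
      · exact ih (by omega) hle
      · have hk := hpos ⟨m, hm⟩
        have hsucc := sCum_succ h ⟨m, hm⟩
        refine ⟨⟨m, hm⟩, (s - sCum h m) / h ⟨m, hm⟩, ⟨?_, ?_⟩, ?_⟩
        · exact div_nonneg (by linarith) hk.le
        · rw [div_le_one hk]
          simp only at hsucc
          linarith
        · field_simp
          ring
  exact key n le_rfl hs

/-- The input vector (for unit peak power) of least total power whose weighted sum is `s`: the
strongest emitters are switched on first. -/
noncomputable def fillVec {n : ℕ} (h : Fin n → ℝ) (s : ℝ) (j : Fin n) : ℝ :=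
  max 0 (min 1 ((s - sCum h j.val) / h j))

/-- The total power of `fillVec`. -/
noncomputable def fillCost {n : ℕ} (h : Fin n → ℝ) (s : ℝ) : ℝ := ∑ j, fillVec h s j

theorem fillVec_mem_Icc {n : ℕ} (h : Fin n → ℝ) (s : ℝ) (j : Fin n) :
    fillVec h s j ∈ Set.Icc (0 : ℝ) 1 :=
  ⟨le_max_left _ _, max_le zero_le_one (min_le_left _ _)⟩

theorem fillCost_nonneg {n : ℕ} (h : Fin n → ℝ) (s : ℝ) : 0 ≤ fillCost h s :=
  Finset.sum_nonneg fun j _ => (fillVec_mem_Icc h s j).1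

theorem continuous_fillVec {n : ℕ} (h : Fin n → ℝ) : Continuous (fillVec h) := by
  unfold fillVec
  fun_prop

theorem continuous_fillCost {n : ℕ} (h : Fin n → ℝ) : Continuous (fillCost h) :=
  continuous_finsetSum _ fun j _ => (continuous_apply j).comp (continuous_fillVec h)

theorem abs_fillCost_sub_le {n : ℕ} {h : Fin n → ℝ} (hpos : ∀ k, 0 < h k) (a b : ℝ) :
    |fillCost h a - fillCost h b| ≤ (∑ k, 1 / h k) * |a - b| := by
  rw [fillCost, fillCost, ← Finset.sum_sub_distrib, Finset.sum_mul]
  refine (Finset.abs_sum_le_sum_abs _ _).trans (Finset.sum_le_sum fun j _ => ?_)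
  have h1 := abs_max_sub_max_le_max (0 : ℝ) (min 1 ((a - sCum h j.val) / h j)) 0
    (min 1 ((b - sCum h j.val) / h j))
  have h2 := abs_min_sub_min_le_max (1 : ℝ) ((a - sCum h j.val) / h j) 1
    ((b - sCum h j.val) / h j)
  have h3 : (a - sCum h j.val) / h j - (b - sCum h j.val) / h j = 1 / h j * (a - b) := by ring
  rw [h3, abs_mul, abs_of_pos (one_div_pos.2 (hpos j)), sub_self, abs_zero,
    max_eq_right (by have := one_div_pos.2 (hpos j); positivity)] at h2
  rw [sub_self, abs_zero] at h1
  exact h1.trans (max_le ((abs_nonneg _).trans h2) h2)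

theorem fillVec_sCum_add {n : ℕ} {h : Fin n → ℝ} (hpos : ∀ k, 0 < h k) (k : Fin n) {t : ℝ}
    (ht : t ∈ Set.Icc (0 : ℝ) 1) (j : Fin n) :
    fillVec h (sCum h k.val + h k * t) j =
      (if j.val < k.val then 1 else 0) + if j = k then t else 0 := by
  have hj := hpos j
  have hk := hpos k
  rw [fillVec]
  rcases lt_trichotomy j.val k.val with hjk | hjk | hjk
  · have h1 := sCum_mono hpos (Nat.succ_le_of_lt hjk)
    rw [Nat.succ_eq_add_one, sCum_succ] at h1
    have h2 : 1 ≤ (sCum h k.val + h k * t - sCum h j.val) / h j := by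
      rw [le_div_iff₀ hj]
      nlinarith [ht.1]
    rw [min_eq_left h2]
    simp [hjk, Fin.ext_iff, hjk.ne]
  · obtain rfl : j = k := Fin.ext hjk
    have h2 : (sCum h j.val + h j * t - sCum h j.val) / h j = t := by
      field_simp
      ring
    rw [h2, min_eq_right ht.2, max_eq_right ht.1]
    simp
  · have h1 := sCum_mono hpos (Nat.succ_le_of_lt hjk)
    rw [Nat.succ_eq_add_one, sCum_succ] at h1
    have h2 : (sCum h k.val + h k * t - sCum h j.val) / h j ≤ 0 :=
      div_nonpos_of_nonpos_of_nonneg (by nlinarith [ht.2]) hj.le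
    rw [max_eq_left ((min_le_right _ _).trans h2)]
    simp [Fin.ext_iff, hjk.ne', not_lt.2 hjk.le]

theorem sum_ite_val_lt {n : ℕ} (k : Fin n) :
    (∑ j : Fin n, if j.val < k.val then (1 : ℝ) else 0) = k.val := by
  rw [Finset.sum_boole]
  congr 1
  have : (Finset.univ.filter fun j : Fin n => j.val < k.val) = Finset.Iio k := by
    ext j
    simp
  rw [this, Fin.card_Iio]

theorem fillCost_sCum_add {n : ℕ} {h : Fin n → ℝ} (hpos : ∀ k, 0 < h k) (k : Fin n) {t : ℝ}
    (ht : t ∈ Set.Icc (0 : ℝ) 1) : fillCost h (sCum h k.val + h k * t) = k.val + t := by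
  simp_rw [fillCost, fillVec_sCum_add hpos k ht, Finset.sum_add_distrib, sum_ite_val_lt]
  simp

theorem sum_mul_fillVec {n : ℕ} {h : Fin n → ℝ} (hpos : ∀ k, 0 < h k) {s : ℝ} (hs0 : 0 < s)
    (hs : s ≤ sCum h n) : ∑ j, h j * fillVec h s j = s := by
  obtain ⟨k, t, ht, rfl⟩ := exists_eq_sCum_add hpos hs0 hs
  simp_rw [fillVec_sCum_add hpos k ht, mul_add, Finset.sum_add_distrib, mul_ite, mul_one,
    mul_zero]
  simp [sCum]

theorem add_sub_div_le_sum {n : ℕ} {h : Fin n → ℝ} (hord : ∀ i j : Fin n, i ≤ j → h j ≤ h i)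
    (hpos : ∀ k, 0 < h k) {x : Fin n → ℝ} (hx : ∀ k, x k ∈ Set.Icc (0 : ℝ) 1) (k : Fin n) :
    k.val + (∑ j, h j * x j - sCum h k.val) / h k ≤ ∑ j, x j := by
  have hk := hpos k
  rw [← sum_ite_val_lt k, sCum, ← Finset.sum_sub_distrib, Finset.sum_div,
    ← Finset.sum_add_distrib]
  refine Finset.sum_le_sum fun j _ => ?_
  by_cases hj : j.val < k.val
  · have := hord j k hj.le
    simp only [hj, if_true]
    rw [← sub_nonneg, show x j - (1 + (h j * x j - h j) / h k) =
      (h j - h k) * (1 - x j) / h k by field_simp; ring]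
    exact div_nonneg (mul_nonneg (by linarith) (by linarith [(hx j).2])) hk.le
  · have := hord k j (not_lt.1 hj)
    simp only [hj, if_false, zero_add, sub_zero]
    rw [div_le_iff₀ hk, mul_comm]
    exact mul_le_mul_of_nonneg_left this (hx j).1

theorem fillCost_le_sum {n : ℕ} {h : Fin n → ℝ} (hord : ∀ i j : Fin n, i ≤ j → h j ≤ h i)
    (hpos : ∀ k, 0 < h k) {x : Fin n → ℝ} (hx : ∀ k, x k ∈ Set.Icc (0 : ℝ) 1) :
    fillCost h (∑ j, h j * x j) ≤ ∑ j, x j := by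
  have h0 : 0 ≤ ∑ j, h j * x j :=
    Finset.sum_nonneg fun j _ => mul_nonneg (hpos j).le (hx j).1
  have h1 : ∑ j, h j * x j ≤ sCum h n := by
    rw [sCum_self]
    exact Finset.sum_le_sum fun j _ => mul_le_of_le_one_right (hpos j).le (hx j).2
  rcases h0.eq_or_lt with h0 | h0
  · rw [← h0, fillCost]
    refine Finset.sum_le_sum fun j _ => ?_
    have h2 : (0 - sCum h j.val) / h j ≤ 0 := by
      refine div_nonpos_of_nonpos_of_nonneg ?_ (hpos j).le
      have := sCum_mono hpos (Nat.zero_le j.val)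
      rw [sCum_zero] at this
      linarith
    rw [fillVec, max_eq_left ((min_le_right _ _).trans h2)]
    exact (hx j).1
  · obtain ⟨k, t, ht, hkt⟩ := exists_eq_sCum_add hpos h0 h1
    have h2 := add_sub_div_le_sum hord hpos hx k
    rw [hkt, fillCost_sCum_add hpos k ht]
    rwa [hkt, add_sub_cancel_left, mul_div_cancel_left₀ _ (hpos k).ne'] at h2

theorem integral_zero_sCum {n : ℕ} (h : Fin n → ℝ) (hpos : ∀ k, 0 < h k) {F : ℝ → ℝ}
    (hF : Continuous F) :
    ∫ s in (0 : ℝ)..sCum h n, F s =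
      ∑ k : Fin n, h k * ∫ t in (0 : ℝ)..1, F (sCum h k.val + h k * t) := by
  have h1 := intervalIntegral.sum_integral_adjacent_intervals (μ := volume) (f := F)
    (a := sCum h) (n := n) fun k _ => hF.intervalIntegrable _ _
  rw [sCum_zero] at h1
  rw [← h1, Finset.sum_range]
  refine Finset.sum_congr rfl fun k _ => ?_
  rw [sCum_succ, intervalIntegral.integral_comp_add_mul _ (hpos k).ne']
  simp [(hpos k).ne']

/-- The normalising constant of the exponential density with rate `μ` truncated to `[0, 1]`. -/
noncomputable def expMass (μ : ℝ) : ℝ := (1 - Real.exp (-μ)) / μ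

/-- The mean of the exponential density with rate `μ` truncated to `[0, 1]`. -/
noncomputable def expMean (μ : ℝ) : ℝ := 1 / μ - Real.exp (-μ) / (1 - Real.exp (-μ))

/-- The normalising constant of the law on indices proportional to `h k * exp (-μ k)`. -/
noncomputable def gainMass {n : ℕ} (h : Fin n → ℝ) (μ : ℝ) : ℝ :=
  ∑ k : Fin n, h k * Real.exp (-(μ * k.val))

/-- The mean of the law on indices proportional to `h k * exp (-μ k)`. -/
noncomputable def gainMean {n : ℕ} (h : Fin n → ℝ) (μ : ℝ) : ℝ :=
  (∑ k : Fin n, h k * k.val * Real.exp (-(μ * k.val))) / gainMass h μ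

theorem one_sub_exp_neg_pos {μ : ℝ} (hμ : 0 < μ) : 0 < 1 - Real.exp (-μ) := by
  have : Real.exp (-μ) < 1 := Real.exp_lt_one_iff.2 (by linarith)
  linarith

theorem expMass_pos {μ : ℝ} (hμ : 0 < μ) : 0 < expMass μ :=
  div_pos (one_sub_exp_neg_pos hμ) hμ

theorem integral_exp_neg_mul_unit {μ : ℝ} (hμ : 0 < μ) :
    ∫ t in (0 : ℝ)..1, Real.exp (-(μ * t)) = expMass μ := by
  have hd : ∀ t ∈ Set.uIcc (0 : ℝ) 1,
      HasDerivAt (fun t => -Real.exp (-(μ * t)) / μ) (Real.exp (-(μ * t))) t := fun t _ => by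
    have h1 : HasDerivAt (fun t : ℝ => -(μ * t)) (-μ) t :=
      ((hasDerivAt_id t).const_mul μ).neg.congr_deriv (by simp)
    refine (h1.exp.neg.div_const μ).congr_deriv ?_
    field_simp
  rw [intervalIntegral.integral_eq_sub_of_hasDerivAt hd
    (Continuous.intervalIntegrable (by fun_prop) _ _), expMass]
  simp
  ring

theorem integral_mul_exp_neg_mul_unit {μ : ℝ} (hμ : 0 < μ) :
    ∫ t in (0 : ℝ)..1, t * Real.exp (-(μ * t)) = expMean μ * expMass μ := by
  have hd : ∀ t ∈ Set.uIcc (0 : ℝ) 1,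
      HasDerivAt (fun t => -((t / μ + 1 / μ ^ 2) * Real.exp (-(μ * t))))
        (t * Real.exp (-(μ * t))) t := fun t _ => by
    have h1 : HasDerivAt (fun t : ℝ => -(μ * t)) (-μ) t :=
      ((hasDerivAt_id t).const_mul μ).neg.congr_deriv (by simp)
    have h2 : HasDerivAt (fun t : ℝ => t / μ + 1 / μ ^ 2) (1 / μ) t :=
      ((hasDerivAt_id t).div_const μ).add_const _
    refine (h2.mul h1.exp).neg.congr_deriv ?_
    field_simp
    ring
  have h1 := (one_sub_exp_neg_pos hμ).ne'
  rw [intervalIntegral.integral_eq_sub_of_hasDerivAt hd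
    (Continuous.intervalIntegrable (by fun_prop) _ _), expMass, expMean]
  simp
  field_simp
  ring

theorem log_expMass_add_le {μ μ' : ℝ} (hμ : 0 < μ) (hμ' : 0 < μ') :
    Real.log (expMass μ') + μ' * expMean μ' ≤ Real.log (expMass μ) + μ * expMean μ' := by
  set c := -((μ - μ') * expMean μ') with hc
  have h1 : Real.exp c * expMass μ' ≤ expMass μ := by
    have h2 : ∫ t in (0 : ℝ)..1, Real.exp c *
        ((1 - c) * Real.exp (-(μ' * t)) - (μ - μ') * (t * Real.exp (-(μ' * t)))) ≤
        ∫ t in (0 : ℝ)..1, Real.exp (-(μ * t)) := by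
      refine intervalIntegral.integral_mono_on zero_le_one
        (Continuous.intervalIntegrable (by fun_prop) _ _)
        (Continuous.intervalIntegrable (by fun_prop) _ _) fun t _ => ?_
      have h3 := Real.add_one_le_exp (-((μ - μ') * t) - c)
      calc _ = Real.exp c * Real.exp (-(μ' * t)) * (-((μ - μ') * t) - c + 1) := by ring
        _ ≤ Real.exp c * Real.exp (-(μ' * t)) * Real.exp (-((μ - μ') * t) - c) := by gcongr
        _ = _ := by
          rw [← Real.exp_add, ← Real.exp_add]
          ring_nf
    rw [intervalIntegral.integral_const_mul, intervalIntegral.integral_sub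
      (Continuous.intervalIntegrable (by fun_prop) _ _)
      (Continuous.intervalIntegrable (by fun_prop) _ _), intervalIntegral.integral_const_mul,
      intervalIntegral.integral_const_mul, integral_exp_neg_mul_unit hμ,
      integral_exp_neg_mul_unit hμ', integral_mul_exp_neg_mul_unit hμ'] at h2
    refine le_trans (le_of_eq ?_) h2
    rw [hc]
    ring
  have h4 := Real.log_le_log (mul_pos (Real.exp_pos c) (expMass_pos hμ')) h1
  rw [Real.log_mul (Real.exp_pos c).ne' (expMass_pos hμ').ne', Real.log_exp] at h4
  linarith

theorem one_div_two_add_le_expMean {μ : ℝ} (hμ : 0 < μ) : 1 / (2 + μ) ≤ expMean μ := by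
  have h1 := Real.quadratic_le_exp_of_nonneg hμ.le
  have h2 : Real.exp (-μ) / (1 - Real.exp (-μ)) = 1 / (Real.exp μ - 1) := by
    have h3 : Real.exp μ - 1 ≠ 0 := by
      have := Real.add_one_lt_exp hμ.ne'
      linarith
    rw [Real.exp_neg]
    field_simp
  rw [expMean, h2]
  have h4 : 1 / (Real.exp μ - 1) ≤ 1 / (μ + μ ^ 2 / 2) :=
    one_div_le_one_div_of_le (by positivity) (by linarith)
  have h5 : 1 / μ - 1 / (μ + μ ^ 2 / 2) = 1 / (2 + μ) := by
    field_simp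
    ring
  linarith

theorem expMean_le_one_div {μ : ℝ} (hμ : 0 < μ) : expMean μ ≤ 1 / μ := by
  have := div_nonneg (Real.exp_pos (-μ)).le (one_sub_exp_neg_pos hμ).le
  rw [expMean]
  linarith

theorem expMean_pos {μ : ℝ} (hμ : 0 < μ) : 0 < expMean μ :=
  (by positivity : 0 < 1 / (2 + μ)).trans_le (one_div_two_add_le_expMean hμ)

theorem expMean_lt_half {μ : ℝ} (hμ : 0 < μ) : expMean μ < 1 / 2 := by
  have hmono : StrictMonoOn (fun x : ℝ => (2 + x) * Real.exp (-x) - (2 - x)) (Set.Ici 0) := by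
    have hderiv : ∀ x : ℝ, HasDerivAt (fun x : ℝ => (2 + x) * Real.exp (-x) - (2 - x))
        (1 - (1 + x) * Real.exp (-x)) x := fun x => by
      have h1 : HasDerivAt (fun x : ℝ => Real.exp (-x)) (-Real.exp (-x)) x := by
        simpa using (hasDerivAt_id x).neg.exp
      have h2 : HasDerivAt (fun x : ℝ => 2 + x) 1 x := (hasDerivAt_id x).const_add 2
      have h3 : HasDerivAt (fun x : ℝ => 2 - x) (-1) x := (hasDerivAt_id x).const_sub 2
      refine ((h2.mul h1).sub h3).congr_deriv ?_
      ring
    refine strictMonoOn_of_deriv_pos (convex_Ici 0) (by fun_prop) fun x hx => ?_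
    rw [interior_Ici] at hx
    have hx' : 0 < x := hx
    rw [(hderiv x).deriv, sub_pos]
    calc (1 + x) * Real.exp (-x) < Real.exp x * Real.exp (-x) := by
          gcongr
          linarith [Real.add_one_lt_exp hx'.ne']
      _ = 1 := by rw [← Real.exp_add]; simp
  have h0 := hmono (Set.mem_Ici.2 le_rfl) (Set.mem_Ici.2 hμ.le) hμ
  simp only [add_zero, neg_zero, Real.exp_zero, mul_one, sub_zero, sub_self] at h0
  have h1 := one_sub_exp_neg_pos hμ
  rw [expMean, div_sub_div _ _ hμ.ne' h1.ne', div_lt_div_iff₀ (by positivity) two_pos]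
  linarith

theorem continuousOn_expMean : ContinuousOn expMean (Set.Ioi 0) := by
  unfold expMean
  refine ContinuousOn.sub (continuousOn_const.div continuousOn_id fun x hx => ne_of_gt hx) ?_
  exact ContinuousOn.div (by fun_prop) (by fun_prop) fun x hx => (one_sub_exp_neg_pos hx).ne'

section Gain

variable {n : ℕ} {h : Fin n → ℝ}

theorem gainMass_pos [NeZero n] (hpos : ∀ k, 0 < h k) (μ : ℝ) : 0 < gainMass h μ :=
  Finset.sum_pos (fun k _ => mul_pos (hpos k) (Real.exp_pos _)) Finset.univ_nonempty

theorem log_gainMass_add_le [NeZero n] (hpos : ∀ k, 0 < h k) (μ μ' : ℝ) :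
    Real.log (gainMass h μ') + μ' * gainMean h μ' ≤
      Real.log (gainMass h μ) + μ * gainMean h μ' := by
  have hm : gainMean h μ' * gainMass h μ' = ∑ k : Fin n, h k * k.val * Real.exp (-(μ' * k.val)) :=
    div_mul_cancel₀ _ (gainMass_pos hpos μ').ne'
  set c := -((μ - μ') * gainMean h μ') with hc
  have h1 : Real.exp c * gainMass h μ' ≤ gainMass h μ := by
    calc Real.exp c * gainMass h μ' =
        Real.exp c * ((1 - c) * gainMass h μ' - (μ - μ') * (gainMean h μ' * gainMass h μ')) := by
          rw [hc]; ring
      _ = ∑ k : Fin n, h k * (Real.exp c * Real.exp (-(μ' * k.val)) *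
            (-((μ - μ') * k.val) - c + 1)) := by
          rw [hm, gainMass, Finset.mul_sum, Finset.mul_sum, ← Finset.sum_sub_distrib,
            Finset.mul_sum]
          exact Finset.sum_congr rfl fun k _ => by ring
      _ ≤ ∑ k : Fin n, h k * (Real.exp c * Real.exp (-(μ' * k.val)) *
            Real.exp (-((μ - μ') * k.val) - c)) := by
          refine Finset.sum_le_sum fun k _ => ?_
          have := hpos k
          gcongr
          exact Real.add_one_le_exp _
      _ = gainMass h μ := by
          refine Finset.sum_congr rfl fun k _ => ?_
          rw [← Real.exp_add, ← Real.exp_add]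
          ring_nf
  have h4 := Real.log_le_log (mul_pos (Real.exp_pos c) (gainMass_pos hpos μ')) h1
  rw [Real.log_mul (Real.exp_pos c).ne' (gainMass_pos hpos μ').ne', Real.log_exp] at h4
  linarith

theorem continuous_gainMean [NeZero n] (hpos : ∀ k, 0 < h k) : Continuous (gainMean h) := by
  unfold gainMean
  refine Continuous.div (by fun_prop) (by unfold gainMass; fun_prop) fun μ => ?_
  exact (gainMass_pos hpos μ).ne'

theorem gainMean_pos (hn : 2 ≤ n) (hpos : ∀ k, 0 < h k) (μ : ℝ) : 0 < gainMean h μ := by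
  have : NeZero n := ⟨by omega⟩
  refine div_pos (Finset.sum_pos' (fun k _ => ?_) ⟨⟨1, by omega⟩, Finset.mem_univ _, ?_⟩)
    (gainMass_pos hpos μ)
  · have := hpos k
    positivity
  · have := hpos ⟨1, by omega⟩
    positivity

theorem alphaTh_eq (h : Fin n → ℝ) : alphaTh h = 1 / 2 + gainMean h 0 := by
  rw [alphaTh, gainMean, gainMass, sCum_self]
  simp
  ring

theorem gainMean_lt_gainMean_zero (hn : 2 ≤ n) (hpos : ∀ k, 0 < h k) {μ : ℝ} (hμ : 0 < μ) :
    gainMean h μ < gainMean h 0 := by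
  have : NeZero n := ⟨by omega⟩
  have hm0 := gainMean_pos hn hpos 0
  have hm : gainMean h 0 * gainMass h 0 = ∑ k : Fin n, h k * k.val * Real.exp (-(0 * k.val)) :=
    div_mul_cancel₀ _ (gainMass_pos hpos 0).ne'
  set m := gainMean h 0
  have hcentre : ∑ k : Fin n, h k * (k.val - m) = 0 := by
    have h1 : ∑ k : Fin n, h k * (k.val - m) =
        ∑ k : Fin n, h k * k.val - m * ∑ k : Fin n, h k := by
      rw [Finset.mul_sum, ← Finset.sum_sub_distrib]
      exact Finset.sum_congr rfl fun k _ => by ring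
    simp only [gainMass, zero_mul, neg_zero, Real.exp_zero, mul_one] at hm
    rw [h1, hm, sub_self]
  have hneg : ∑ k : Fin n, h k * ((k.val - m) *
      (Real.exp (-(μ * k.val)) - Real.exp (-(μ * m)))) < 0 := by
    refine Finset.sum_neg' (fun k _ => ?_) ⟨⟨0, by omega⟩, Finset.mem_univ _, ?_⟩
    · refine mul_nonpos_of_nonneg_of_nonpos (hpos k).le ?_
      rcases le_total (k.val : ℝ) m with hk | hk
      · refine mul_nonpos_of_nonpos_of_nonneg (by linarith) (sub_nonneg.2 ?_)
        gcongr
      · refine mul_nonpos_of_nonneg_of_nonpos (by linarith) (sub_nonpos.2 ?_)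
        gcongr
    · refine mul_neg_of_pos_of_neg (hpos _) (mul_neg_of_neg_of_pos (by simpa using hm0) ?_)
      rw [sub_pos]
      simpa using mul_pos hμ hm0
  rw [gainMean, div_lt_iff₀ (gainMass_pos hpos μ)]
  have h2 : ∑ k : Fin n, h k * ((k.val - m) * (Real.exp (-(μ * k.val)) - Real.exp (-(μ * m)))) =
      ∑ k : Fin n, h k * k.val * Real.exp (-(μ * k.val)) - m * gainMass h μ -
        Real.exp (-(μ * m)) * ∑ k : Fin n, h k * (k.val - m) := by
    rw [gainMass, Finset.mul_sum, Finset.mul_sum, ← Finset.sum_sub_distrib,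
      ← Finset.sum_sub_distrib]
    exact Finset.sum_congr rfl fun k _ => by ring
  rw [hcentre] at h2
  linarith

theorem gainMean_le (hn : 2 ≤ n) (hpos : ∀ k, 0 < h k) {μ : ℝ} (hμ : 0 < μ) :
    gainMean h μ ≤ (∑ k : Fin n, h k * k.val) * Real.exp (-μ) / h ⟨0, by omega⟩ := by
  have hsum : ∑ k : Fin n, h k * k.val * Real.exp (-(μ * k.val)) ≤
      (∑ k : Fin n, h k * k.val) * Real.exp (-μ) := by
    rw [Finset.sum_mul]
    refine Finset.sum_le_sum fun k _ => ?_
    rcases Nat.eq_zero_or_pos k.val with hk | hk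
    · simp [hk]
    · have h1 : (1 : ℝ) ≤ k.val := by exact_mod_cast hk
      have := hpos k
      gcongr
      nlinarith
  have hmass : h ⟨0, by omega⟩ ≤ gainMass h μ := by
    have h1 := Finset.single_le_sum (f := fun k : Fin n => h k * Real.exp (-(μ * k.val)))
      (fun k _ => (mul_pos (hpos k) (Real.exp_pos _)).le) (Finset.mem_univ ⟨0, by omega⟩)
    simpa [gainMass] using h1
  rw [gainMean]
  refine div_le_div₀ ?_ hsum (hpos _) hmass
  exact mul_nonneg (Finset.sum_nonneg fun k _ => mul_nonneg (hpos k).le (by positivity))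
    (Real.exp_pos _).le

theorem exists_expMean_add_gainMean_eq (hn : 2 ≤ n) (hpos : ∀ k, 0 < h k) {α : ℝ} (hα0 : 0 < α)
    (hαth : α < alphaTh h) : ∃ μ, 0 < μ ∧ expMean μ + gainMean h μ = α := by
  have : NeZero n := ⟨by omega⟩
  have hcont : ContinuousOn (fun μ => expMean μ + gainMean h μ) (Set.Ioi 0) :=
    continuousOn_expMean.add (continuous_gainMean hpos).continuousOn
  obtain ⟨a, ha, ha'⟩ : ∃ a, 0 < a ∧ α ≤ expMean a + gainMean h a := by
    have hc : ContinuousAt (fun μ => 1 / (2 + μ) + gainMean h μ) 0 :=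
      ContinuousAt.add (ContinuousAt.div (by fun_prop) (by fun_prop) (by norm_num))
        (continuous_gainMean hpos).continuousAt
    rw [alphaTh_eq] at hαth
    have hev := hc.eventually (lt_mem_nhds (a := α) (by simpa using hαth))
    obtain ⟨a, ha, ha0⟩ := ((hev.filter_mono nhdsWithin_le_nhds).and
      (self_mem_nhdsWithin (s := Set.Ioi (0 : ℝ)))).exists
    exact ⟨a, ha0, ha.le.trans (by gcongr; exact one_div_two_add_le_expMean ha0)⟩
  obtain ⟨b, hb, hb'⟩ : ∃ b, 0 < b ∧ expMean b + gainMean h b ≤ α := by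
    have hexp : Tendsto (fun μ : ℝ => Real.exp (-μ)) atTop (nhds 0) :=
      Real.tendsto_exp_atBot.comp tendsto_neg_atTop_atBot
    have ht : Tendsto (fun μ : ℝ => 1 / μ +
        (∑ k : Fin n, h k * k.val) * Real.exp (-μ) / h ⟨0, by omega⟩) atTop (nhds 0) := by
      have := (tendsto_inv_atTop_zero (𝕜 := ℝ)).add
        ((hexp.const_mul (∑ k : Fin n, h k * k.val)).div_const (h ⟨0, by omega⟩))
      simpa using this
    obtain ⟨b, hb, hb0⟩ := ((ht.eventually (gt_mem_nhds hα0)).and (eventually_gt_atTop 0)).exists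
    exact ⟨b, hb0, (add_le_add (expMean_le_one_div hb0) (gainMean_le hn hpos hb0)).trans hb.le⟩
  exact isPreconnected_Ioi.intermediate_value hb ha hcont ⟨hb', ha'⟩

end Gain

section Potential

variable {n : ℕ} {h : Fin n → ℝ}

theorem integral_exp_neg_fillCost (hpos : ∀ k, 0 < h k) {μ : ℝ} (hμ : 0 < μ) :
    ∫ s in (0 : ℝ)..sCum h n, Real.exp (-(μ * fillCost h s)) = gainMass h μ * expMass μ := by
  have hc := continuous_fillCost h
  rw [integral_zero_sCum h hpos (by fun_prop), gainMass, Finset.sum_mul]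
  refine Finset.sum_congr rfl fun k _ => ?_
  have h1 : ∫ t in (0 : ℝ)..1, Real.exp (-(μ * fillCost h (sCum h k.val + h k * t))) =
      ∫ t in (0 : ℝ)..1, Real.exp (-(μ * k.val)) * Real.exp (-(μ * t)) := by
    refine intervalIntegral.integral_congr fun t ht => ?_
    rw [Set.uIcc_of_le zero_le_one] at ht
    rw [fillCost_sCum_add hpos k ht, ← Real.exp_add]
    ring_nf
  rw [h1, intervalIntegral.integral_const_mul, integral_exp_neg_mul_unit hμ, mul_assoc]

theorem integral_fillCost_mul_exp_neg_fillCost [NeZero n] (hpos : ∀ k, 0 < h k) {μ : ℝ}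
    (hμ : 0 < μ) :
    ∫ s in (0 : ℝ)..sCum h n, fillCost h s * Real.exp (-(μ * fillCost h s)) =
      (expMean μ + gainMean h μ) * (gainMass h μ * expMass μ) := by
  have hc := continuous_fillCost h
  have hm : gainMean h μ * gainMass h μ = ∑ k : Fin n, h k * k.val * Real.exp (-(μ * k.val)) :=
    div_mul_cancel₀ _ (gainMass_pos hpos μ).ne'
  rw [integral_zero_sCum h hpos (by fun_prop), add_mul, ← mul_assoc (gainMean h μ), hm, gainMass,
    Finset.sum_mul, Finset.sum_mul, Finset.mul_sum, ← Finset.sum_add_distrib]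
  refine Finset.sum_congr rfl fun k _ => ?_
  have h1 : ∫ t in (0 : ℝ)..1, fillCost h (sCum h k.val + h k * t) *
      Real.exp (-(μ * fillCost h (sCum h k.val + h k * t))) =
      ∫ t in (0 : ℝ)..1, (Real.exp (-(μ * k.val)) * (k.val * Real.exp (-(μ * t))) +
        Real.exp (-(μ * k.val)) * (t * Real.exp (-(μ * t)))) := by
    refine intervalIntegral.integral_congr fun t ht => ?_
    rw [Set.uIcc_of_le zero_le_one] at ht
    rw [fillCost_sCum_add hpos k ht,
      show -(μ * (k.val + t)) = -(μ * k.val) + -(μ * t) by ring, Real.exp_add]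
    ring
  rw [h1, intervalIntegral.integral_add (Continuous.intervalIntegrable (by fun_prop) _ _)
    (Continuous.intervalIntegrable (by fun_prop) _ _), intervalIntegral.integral_const_mul,
    intervalIntegral.integral_const_mul, intervalIntegral.integral_const_mul,
    integral_exp_neg_mul_unit hμ, integral_mul_exp_neg_mul_unit hμ]
  ring

/-- The distance from `s` to the interval `[0, S]`. -/
noncomputable def outerDist (S s : ℝ) : ℝ := max 0 (-s) + max 0 (s - S)

theorem continuous_outerDist (S : ℝ) : Continuous (outerDist S) := by
  unfold outerDist
  fun_prop

theorem outerDist_nonneg (S s : ℝ) : 0 ≤ outerDist S s :=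
  add_nonneg (le_max_left _ _) (le_max_left _ _)

theorem outerDist_add_le {S s : ℝ} (hs : s ∈ Set.Icc 0 S) (e : ℝ) :
    outerDist S (s + e) ≤ |e| := by
  have h1 := hs.1
  have h2 := hs.2
  rw [outerDist]
  rcases le_total (s + e) 0 with h3 | h3
  · rw [max_eq_right (by linarith), max_eq_left (by linarith)]
    linarith [neg_le_abs e]
  · rw [max_eq_left (by linarith), zero_add]
    exact max_le (abs_nonneg e) (by linarith [le_abs_self e])

theorem exp_neg_fillCost_add_outerDist_le (hpos : ∀ k, 0 < h k) {μ b : ℝ} (hμ : 0 < μ)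
    (hb : 0 < b) :
    Integrable (fun s => Real.exp (-(μ * fillCost h s + b * outerDist (sCum h n) s))) ∧
    ∫ s, Real.exp (-(μ * fillCost h s + b * outerDist (sCum h n) s)) ≤
      gainMass h μ * expMass μ + 2 / b := by
  have hc := continuous_fillCost h
  have hd := continuous_outerDist (sCum h n)
  have hS : 0 ≤ sCum h n := by simpa [sCum_zero] using sCum_mono hpos (Nat.zero_le n)
  set S := sCum h n with hSdef
  have i1 : Integrable ((Set.Ioc 0 S).indicator fun s => Real.exp (-(μ * fillCost h s))) := by
    rw [integrable_indicator_iff measurableSet_Ioc]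
    have : Continuous fun s => Real.exp (-(μ * fillCost h s)) := by fun_prop
    exact this.integrableOn_Ioc
  have i2 : Integrable ((Set.Iic 0).indicator fun s => Real.exp (b * s)) := by
    rw [integrable_indicator_iff measurableSet_Iic]
    exact integrableOn_exp_mul_Iic hb 0
  have i3 : Integrable ((Set.Ioi S).indicator fun s => Real.exp (b * S) * Real.exp (-b * s)) := by
    rw [integrable_indicator_iff measurableSet_Ioi]
    exact (integrableOn_exp_mul_Ioi (by linarith) S).const_mul _
  have hle : ∀ s, Real.exp (-(μ * fillCost h s + b * outerDist S s)) ≤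
      (Set.Ioc 0 S).indicator (fun s => Real.exp (-(μ * fillCost h s))) s +
      (Set.Iic 0).indicator (fun s => Real.exp (b * s)) s +
      (Set.Ioi S).indicator (fun s => Real.exp (b * S) * Real.exp (-b * s)) s := by
    intro s
    have hφ := fillCost_nonneg h s
    have hμφ : 0 ≤ μ * fillCost h s := mul_nonneg hμ.le hφ
    rcases le_or_gt s 0 with h1 | h1
    · have h2 : s ∉ Set.Ioc 0 S := fun h => absurd h.1 (not_lt.2 h1)
      have h3 : s ∉ Set.Ioi S := fun h => absurd (lt_of_le_of_lt hS h) (not_lt.2 h1)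
      rw [Set.indicator_of_notMem h2, Set.indicator_of_notMem h3,
        Set.indicator_of_mem (Set.mem_Iic.2 h1), outerDist, max_eq_right (by linarith),
        max_eq_left (by linarith), add_zero, zero_add, add_zero]
      gcongr
      linarith
    · have h2 : s ∉ Set.Iic 0 := not_le.2 h1
      rcases le_or_gt s S with h3 | h3
      · have h4 : s ∉ Set.Ioi S := not_lt.2 h3
        rw [Set.indicator_of_mem (show s ∈ Set.Ioc 0 S from ⟨h1, h3⟩),
          Set.indicator_of_notMem h2, Set.indicator_of_notMem h4,
          add_zero, add_zero]
        gcongr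
        have := outerDist_nonneg S s
        nlinarith
      · have h4 : s ∉ Set.Ioc 0 S := fun h => absurd h.2 (not_le.2 h3)
        rw [Set.indicator_of_notMem h4,
          Set.indicator_of_notMem h2, Set.indicator_of_mem (Set.mem_Ioi.2 h3), zero_add, zero_add,
          outerDist, max_eq_left (by linarith), max_eq_right (by linarith), ← Real.exp_add]
        gcongr
        linarith
  have hdom := (i1.add i2).add i3
  have hint : Integrable (fun s => Real.exp (-(μ * fillCost h s + b * outerDist S s))) := by
    refine hdom.mono' (Continuous.aestronglyMeasurable (by fun_prop)) (Eventually.of_forall ?_)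
    intro s
    rw [Real.norm_of_nonneg (Real.exp_pos _).le]
    exact hle s
  refine ⟨hint, (integral_mono hint hdom hle).trans (le_of_eq ?_)⟩
  rw [integral_add' (i1.add i2) i3, integral_add' i1 i2, integral_indicator measurableSet_Ioc,
    integral_indicator measurableSet_Iic, integral_indicator measurableSet_Ioi,
    ← intervalIntegral.integral_of_le hS, integral_exp_neg_fillCost hpos hμ,
    integral_exp_mul_Iic hb, integral_const_mul, integral_exp_mul_Ioi (by linarith)]
  have : Real.exp (b * S) * (-Real.exp (-b * S) / -b) = 1 / b := by
    rw [neg_div_neg_eq, ← mul_div_assoc, ← Real.exp_add]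
    simp
  rw [this]
  simp
  ring

theorem integrable_exp_mul_abs_gaussianReal (v : ℝ≥0) (c : ℝ) :
    Integrable (fun z => Real.exp (c * |z|)) (gaussianReal 0 v) :=
  integrable_exp_mul_abs (integrable_exp_mul_gaussianReal c) (integrable_exp_mul_gaussianReal (-c))

theorem integrable_abs_gaussianReal (v : ℝ≥0) : Integrable (fun z => |z|) (gaussianReal 0 v) :=
  ((memLp_id_gaussianReal' 1 (by simp)).integrable le_rfl).abs

theorem mutualInfo_misoJoint_le (hord : ∀ i j : Fin n, i ≤ j → h j ≤ h i) (hpos : ∀ k, 0 < h k)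
    {v : ℝ≥0} (hv : 0 < v) {A α μ b : ℝ} (hA : 0 < A) (hμ : 0 < μ) (hb : 0 < b)
    {P : Measure (Fin n → ℝ)} [IsProbabilityMeasure P]
    (hP : ∀ k, ∀ᵐ x ∂P, x k ∈ Set.Icc 0 A) (hPα : ∑ k, ∫ x, x k ∂P ≤ α * A) :
    mutualInfo (misoJoint h v P) ≤
      ((-(1 / 2 * Real.log (2 * π * Real.exp 1 * v)) +
        (μ * α + (μ * (∑ k, 1 / h k) + b) / A * ∫ z, |z| ∂(gaussianReal 0 v) +
          Real.log (A * (gainMass h μ * expMass μ + 2 / b))) : ℝ) : EReal) := by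
  set L := ∑ k, 1 / h k with hL
  have hL0 : 0 ≤ L := Finset.sum_nonneg fun k _ => (one_div_pos.2 (hpos k)).le
  have hc := continuous_fillCost h
  have hd := continuous_outerDist (sCum h n)
  have hu : Measurable fun x : Fin n → ℝ => ∑ k, h k * x k := by fun_prop
  have hPall : ∀ᵐ x ∂P, ∀ k, x k ∈ Set.Icc 0 A := ae_all_iff.2 hP
  have hscale : ∀ x : Fin n → ℝ, (∀ k, x k ∈ Set.Icc 0 A) →
      fillCost h ((∑ k, h k * x k) / A) ≤ (∑ k, x k) / A ∧
      (∑ k, h k * x k) / A ∈ Set.Icc 0 (sCum h n) := by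
    intro x hx
    have hx' : ∀ k, x k / A ∈ Set.Icc (0 : ℝ) 1 := fun k =>
      ⟨div_nonneg (hx k).1 hA.le, (div_le_one hA).2 (hx k).2⟩
    have h1 := fillCost_le_sum hord hpos hx'
    have h2 : ∑ k, h k * (x k / A) = (∑ k, h k * x k) / A := by
      rw [Finset.sum_div]
      exact Finset.sum_congr rfl fun k _ => by ring
    rw [h2, ← Finset.sum_div] at h1
    refine ⟨h1, ?_⟩
    rw [← h2, sCum_self]
    exact ⟨Finset.sum_nonneg fun k _ => mul_nonneg (hpos k).le (hx' k).1,
      Finset.sum_le_sum fun k _ => mul_le_of_le_one_right (hpos k).le (hx' k).2⟩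
  have hB : ∀ᵐ x ∂P, |∑ k, h k * x k| ≤ A * sCum h n := by
    filter_upwards [hPall] with x hx
    have h1 := (hscale x hx).2
    have h2 : ∑ k, h k * x k = A * ((∑ k, h k * x k) / A) := by field_simp
    rw [abs_le]
    constructor <;> nlinarith [h1.1, h1.2]
  set r : ℝ → ℝ := fun y => μ * fillCost h (y / A) + b * outerDist (sCum h n) (y / A) with hr
  have hrc : Continuous r := by fun_prop
  have hr0 : ∀ y, 0 ≤ r y := fun y =>
    add_nonneg (mul_nonneg hμ.le (fillCost_nonneg _ _)) (mul_nonneg hb.le (outerDist_nonneg _ _))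
  obtain ⟨hexp, hexple⟩ := exp_neg_fillCost_add_outerDist_le hpos hμ hb
  have hexpA : Integrable fun y => Real.exp (-r y) := hexp.comp_div hA.ne'
  have hexpAle : ∫ y, Real.exp (-r y) ≤ A * (gainMass h μ * expMass μ + 2 / b) := by
    have h1 := Measure.integral_comp_div
      (fun s => Real.exp (-(μ * fillCost h s + b * outerDist (sCum h n) s))) A
    rw [abs_of_pos hA, smul_eq_mul] at h1
    rw [hr, h1]
    gcongr
  have hxi : ∀ k, Integrable (fun x : Fin n → ℝ => x k) P := fun k => by
    refine Integrable.of_bound (C := A) (measurable_pi_apply k).aestronglyMeasurable ?_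
    filter_upwards [hP k] with x hx
    rw [Real.norm_of_nonneg hx.1]
    exact hx.2
  have hsum : Integrable (fun x : Fin n → ℝ => ∑ k, x k) P :=
    integrable_finsetSum _ fun k _ => hxi k
  have g1 : Integrable (fun p : (Fin n → ℝ) × ℝ => μ / A * ∑ k, p.1 k)
      (P.prod (gaussianReal 0 v)) := (hsum.const_mul (μ / A)).comp_fst _
  have g2 : Integrable (fun p : (Fin n → ℝ) × ℝ => (μ * L + b) / A * |p.2|)
      (P.prod (gaussianReal 0 v)) :=
    ((integrable_abs_gaussianReal v).const_mul ((μ * L + b) / A)).comp_snd P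
  have hPall' : ∀ᵐ p ∂(P.prod (gaussianReal 0 v)), ∀ k, p.1 k ∈ Set.Icc 0 A :=
    Measure.quasiMeasurePreserving_fst.ae hPall
  have hrle : ∀ᵐ p ∂(P.prod (gaussianReal 0 v)), r ((∑ k, h k * p.1 k) + p.2) ≤
      μ / A * ∑ k, p.1 k + (μ * L + b) / A * |p.2| := by
    filter_upwards [hPall'] with p hp
    obtain ⟨h1, h2⟩ := hscale p.1 hp
    have h3 := (le_abs_self _).trans (abs_fillCost_sub_le hpos
      ((∑ k, h k * p.1 k) / A + p.2 / A) ((∑ k, h k * p.1 k) / A))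
    have h4 := outerDist_add_le h2 (p.2 / A)
    rw [add_sub_cancel_left, abs_div, abs_of_pos hA] at h3
    rw [abs_div, abs_of_pos hA] at h4
    rw [hr]
    simp only [add_div]
    calc _ ≤ μ * ((∑ k, p.1 k) / A + L * (|p.2| / A)) + b * (|p.2| / A) := by
          gcongr
          linarith
      _ = _ := by ring
  have hri : Integrable (fun p : (Fin n → ℝ) × ℝ => r ((∑ k, h k * p.1 k) + p.2))
      (P.prod (gaussianReal 0 v)) := by
    refine (g1.add g2).mono' (Measurable.aestronglyMeasurable (by fun_prop)) ?_
    filter_upwards [hrle] with p hp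
    rw [Real.norm_of_nonneg (hr0 _)]
    exact hp
  have hrint : ∫ p, r ((∑ k, h k * p.1 k) + p.2) ∂(P.prod (gaussianReal 0 v)) ≤
      μ * α + (μ * L + b) / A * ∫ z, |z| ∂(gaussianReal 0 v) := by
    refine (integral_mono_ae hri (g1.add g2) hrle).trans ?_
    rw [integral_add' g1 g2,
      integral_fun_fst (μ := P) (ν := gaussianReal 0 v) (fun x => μ / A * ∑ k, x k),
      integral_fun_snd (μ := P) (ν := gaussianReal 0 v) (fun z => (μ * L + b) / A * |z|)]
    simp only [probReal_univ, one_smul]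
    rw [integral_const_mul, integral_const_mul, integral_finsetSum _ fun k _ => hxi k]
    gcongr ?_ + _
    calc μ / A * ∑ k, ∫ x, x k ∂P ≤ μ / A * (α * A) := by gcongr
      _ = μ * α := by field_simp
  have hZ : 0 < gainMass h μ * expMass μ + 2 / b := by
    have h1 : 0 ≤ gainMass h μ :=
      Finset.sum_nonneg fun k _ => mul_nonneg (hpos k).le (Real.exp_pos _).le
    have := expMass_pos hμ
    positivity
  have key := neg_integral_log_outputDensity_le hu hv hB hrc.measurable hri hexpA
    (mul_pos hA hZ) hexpAle
  have hmi := mutualInfo_shear (P := P) hu hv hB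
  rw [misoJoint, hmi, EReal.coe_le_coe_iff]
  linarith

end Potential

section Staircase

variable {n : ℕ} {h : Fin n → ℝ}

/-- The probability measure on `[0, sCum h n]` whose density is proportional to
`exp (-(μ * fillCost h s))`. -/
noncomputable def stairMeasure (h : Fin n → ℝ) (μ : ℝ) : Measure ℝ :=
  (volume.restrict (Set.Ioc 0 (sCum h n))).withDensity fun s =>
    ENNReal.ofReal (Real.exp (-(μ * fillCost h s)) / (gainMass h μ * expMass μ))

theorem ae_stairMeasure (h : Fin n → ℝ) (μ : ℝ) :
    ∀ᵐ s ∂(stairMeasure h μ), s ∈ Set.Ioc 0 (sCum h n) :=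
  (withDensity_absolutelyContinuous _ _).ae_le (ae_restrict_mem measurableSet_Ioc)

theorem integral_stairMeasure [NeZero n] (hpos : ∀ k, 0 < h k) {μ : ℝ} (hμ : 0 < μ) (f : ℝ → ℝ) :
    ∫ s, f s ∂(stairMeasure h μ) =
      (∫ s in Set.Ioc 0 (sCum h n), Real.exp (-(μ * fillCost h s)) * f s) /
        (gainMass h μ * expMass μ) := by
  have hc := continuous_fillCost h
  have hZ : 0 < gainMass h μ * expMass μ := mul_pos (gainMass_pos hpos μ) (expMass_pos hμ)
  rw [stairMeasure, integral_withDensity_eq_integral_toReal_smul (Measurable.ennreal_ofReal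
    (by fun_prop)) (Eventually.of_forall fun _ => ENNReal.ofReal_lt_top), ← integral_div]
  refine integral_congr_ae (Eventually.of_forall fun s => ?_)
  simp only [smul_eq_mul]
  rw [ENNReal.toReal_ofReal (by positivity)]
  ring

theorem isProbabilityMeasure_stairMeasure [NeZero n] (hpos : ∀ k, 0 < h k) {μ : ℝ} (hμ : 0 < μ) :
    IsProbabilityMeasure (stairMeasure h μ) := by
  have hc := continuous_fillCost h
  have hS : 0 ≤ sCum h n := by simpa [sCum_zero] using sCum_mono hpos (Nat.zero_le n)
  have hZ : 0 < gainMass h μ * expMass μ := mul_pos (gainMass_pos hpos μ) (expMass_pos hμ)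
  have hcont : Continuous fun s =>
    Real.exp (-(μ * fillCost h s)) / (gainMass h μ * expMass μ) := by fun_prop
  refine ⟨?_⟩
  rw [stairMeasure, withDensity_apply _ MeasurableSet.univ, Measure.restrict_univ,
    ← ofReal_integral_eq_lintegral_ofReal hcont.integrableOn_Ioc
      (Eventually.of_forall fun s => by positivity), integral_div,
    ← intervalIntegral.integral_of_le hS, integral_exp_neg_fillCost hpos hμ, div_self hZ.ne',
    ENNReal.ofReal_one]

theorem integral_fillCost_stairMeasure [NeZero n] (hpos : ∀ k, 0 < h k) {μ : ℝ} (hμ : 0 < μ) :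
    ∫ s, fillCost h s ∂(stairMeasure h μ) = expMean μ + gainMean h μ := by
  have hS : 0 ≤ sCum h n := by simpa [sCum_zero] using sCum_mono hpos (Nat.zero_le n)
  have hZ : 0 < gainMass h μ * expMass μ := mul_pos (gainMass_pos hpos μ) (expMass_pos hμ)
  rw [integral_stairMeasure hpos hμ, ← intervalIntegral.integral_of_le hS]
  simp_rw [mul_comm (Real.exp _)]
  rw [integral_fillCost_mul_exp_neg_fillCost hpos hμ, mul_div_cancel_right₀ _ hZ.ne']

theorem integrable_gaussianPDFReal_mul_exp_mul_abs {v : ℝ≥0} (hv : 0 < v) (c : ℝ) :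
    Integrable fun z => gaussianPDFReal 0 v z * Real.exp (c * |z|) := by
  have h1 := integrable_exp_mul_abs_gaussianReal v c
  rw [gaussianReal_of_var_ne_zero _ hv.ne', integrable_withDensity_iff_integrable_smul'
    (measurable_gaussianPDF 0 v) (Eventually.of_forall fun _ => gaussianPDF_lt_top)] at h1
  simpa only [toReal_gaussianPDF, smul_eq_mul] using h1

theorem integral_gaussianPDFReal_comp_mul_exp {v : ℝ≥0} (hv : 0 < v) {A : ℝ} (hA : 0 < A)
    (c y : ℝ) :
    Integrable (fun s => gaussianPDFReal 0 v (y - A * s) * Real.exp (c * |y - A * s|)) ∧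
    ∫ s, gaussianPDFReal 0 v (y - A * s) * Real.exp (c * |y - A * s|) =
      (∫ z, Real.exp (c * |z|) ∂(gaussianReal 0 v)) / A := by
  have h1 := integrable_gaussianPDFReal_mul_exp_mul_abs hv c
  refine ⟨(h1.comp_sub_left y).comp_mul_left' hA.ne', ?_⟩
  have h2 := Measure.integral_comp_mul_left
    (fun t => gaussianPDFReal 0 v (y - t) * Real.exp (c * |y - t|)) A
  rw [h2, integral_sub_left_eq_self
    (fun z => gaussianPDFReal 0 v z * Real.exp (c * |z|)) volume y,
    integral_gaussianReal_eq_integral_smul hv.ne', abs_of_pos (inv_pos.2 hA)]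
  simp only [smul_eq_mul]
  ring

theorem le_misoCapacity [NeZero n] (hpos : ∀ k, 0 < h k) {v : ℝ≥0} (hv : 0 < v) {A μ : ℝ}
    (hA : 0 < A) (hμ : 0 < μ) :
    ((-(1 / 2 * Real.log (2 * π * Real.exp 1 * v)) +
      (μ * (expMean μ + gainMean h μ) -
        μ * (∑ k, 1 / h k) / A * ∫ z, |z| ∂(gaussianReal 0 v) -
        Real.log ((∫ z, Real.exp (μ * (∑ k, 1 / h k) / A * |z|) ∂(gaussianReal 0 v)) /
          (A * (gainMass h μ * expMass μ)))) : ℝ) : EReal) ≤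
      misoCapacity h v A ((expMean μ + gainMean h μ) * A) := by
  have hZ : 0 < gainMass h μ * expMass μ := mul_pos (gainMass_pos hpos μ) (expMass_pos hμ)
  have hc := continuous_fillCost h
  have hfv := continuous_fillVec h
  have := isProbabilityMeasure_stairMeasure hpos hμ
  set Q := stairMeasure h μ with hQ
  set c := μ * (∑ k, 1 / h k) / A with hcdef
  have hL0 : 0 ≤ ∑ k, 1 / h k := Finset.sum_nonneg fun k _ => (one_div_pos.2 (hpos k)).le
  set M := ∫ z, Real.exp (c * |z|) ∂(gaussianReal 0 v) with hM
  have hM0 : 0 < M := integral_exp_pos (integrable_exp_mul_abs_gaussianReal v c)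
  have hX : Measurable fun s => A • fillVec h s := (hfv.const_smul A).measurable
  have hu : Measurable fun x : Fin n → ℝ => ∑ k, h k * x k := by fun_prop
  set P := Q.map fun s => A • fillVec h s with hPdef
  have : IsProbabilityMeasure P := Measure.isProbabilityMeasure_map hX.aemeasurable
  have hPIcc : ∀ k, ∀ᵐ x ∂P, x k ∈ Set.Icc 0 A := fun k => by
    rw [hPdef, ae_map_iff hX.aemeasurable ((measurable_pi_apply k) measurableSet_Icc)]
    refine Eventually.of_forall fun s => ?_
    have h1 := fillVec_mem_Icc h s k
    exact ⟨mul_nonneg hA.le h1.1, mul_le_of_le_one_right hA.le h1.2⟩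
  have hux : ∀ s ∈ Set.Ioc 0 (sCum h n), ∑ k, h k * (A • fillVec h s) k = A * s := fun s hs => by
    rw [← sum_mul_fillVec hpos hs.1 hs.2, Finset.mul_sum]
    refine Finset.sum_congr rfl fun k _ => ?_
    rw [sum_mul_fillVec hpos hs.1 hs.2, Pi.smul_apply, smul_eq_mul]
    ring
  have hfi : ∀ k, Integrable (fun s => fillVec h s k) Q := fun k => by
    refine Integrable.of_bound (C := 1)
      ((continuous_apply k).comp hfv).aestronglyMeasurable (Eventually.of_forall fun s => ?_)
    have h1 := fillVec_mem_Icc h s k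
    rw [Real.norm_of_nonneg h1.1]
    exact h1.2
  have hmean : ∑ k, ∫ x, x k ∂P ≤ (expMean μ + gainMean h μ) * A := by
    refine le_of_eq ?_
    have h1 : ∀ k, ∫ x, x k ∂P = A * ∫ s, fillVec h s k ∂Q := fun k => by
      rw [hPdef, integral_map hX.aemeasurable (measurable_pi_apply k).aestronglyMeasurable,
        ← integral_const_mul]
      rfl
    simp_rw [h1]
    rw [← Finset.mul_sum, ← integral_finsetSum _ fun k _ => hfi k, mul_comm A]
    congr 1
    exact integral_fillCost_stairMeasure hpos hμ
  refine le_trans ?_ (le_iSup₂_of_le (f := fun (μ : Measure (Fin n → ℝ)) _ =>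
    mutualInfo (misoJoint h v μ)) P ⟨this, hPIcc, hmean⟩ le_rfl)
  have hB : ∀ᵐ x ∂P, |∑ k, h k * x k| ≤ ∑ k, h k * A := by
    filter_upwards [ae_all_iff.2 hPIcc] with x hx
    rw [abs_of_nonneg (Finset.sum_nonneg fun k _ => mul_nonneg (hpos k).le (hx k).1)]
    exact Finset.sum_le_sum fun k _ => mul_le_mul_of_nonneg_left (hx k).2 (hpos k).le
  have hlip : ∀ a b : ℝ, μ * fillCost h (a / A) - c * |a - b| ≤ μ * fillCost h (b / A) := by
    intro a b
    have h1 := (le_abs_self _).trans (abs_fillCost_sub_le hpos (a / A) (b / A))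
    rw [← sub_div, abs_div, abs_of_pos hA] at h1
    have h2 : c * |a - b| = μ * ((∑ k, 1 / h k) * (|a - b| / A)) := by rw [hcdef]; ring
    rw [h2]
    nlinarith
  have hdens : ∀ y, outputDensity P (fun x => ∑ k, h k * x k) v y ≤
      M / (A * (gainMass h μ * expMass μ)) * Real.exp (-(μ * fillCost h (y / A))) := by
    intro y
    obtain ⟨hi, hint⟩ := integral_gaussianPDFReal_comp_mul_exp hv hA c y
    have h1 : outputDensity P (fun x => ∑ k, h k * x k) v y =
        (∫ s in Set.Ioc 0 (sCum h n), Real.exp (-(μ * fillCost h s)) *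
          gaussianPDFReal 0 v (y - A * s)) / (gainMass h μ * expMass μ) := by
      have hm : Measurable fun x : Fin n → ℝ => gaussianPDFReal 0 v (y - ∑ k, h k * x k) :=
        (measurable_gaussianPDFReal 0 v).comp (measurable_const.sub hu)
      rw [outputDensity, hPdef, integral_map hX.aemeasurable hm.aestronglyMeasurable,
        integral_stairMeasure hpos hμ]
      congr 1
      refine setIntegral_congr_fun measurableSet_Ioc fun s hs => ?_
      rw [hux s hs]
    have h2 : ∫ s in Set.Ioc 0 (sCum h n), Real.exp (-(μ * fillCost h s)) *
          gaussianPDFReal 0 v (y - A * s) ≤ Real.exp (-(μ * fillCost h (y / A))) * (M / A) := by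
      rw [← hint, ← integral_const_mul]
      refine (integral_mono_of_nonneg ?_ (hi.const_mul _).integrableOn ?_).trans
        (setIntegral_le_integral (hi.const_mul _) ?_)
      · exact Eventually.of_forall fun s =>
          mul_nonneg (Real.exp_pos _).le (gaussianPDFReal_nonneg 0 v _)
      · refine Eventually.of_forall fun s => ?_
        have h3 := hlip y (A * s)
        rw [mul_div_cancel_left₀ _ hA.ne'] at h3
        simp only
        calc _ ≤ Real.exp (-(μ * fillCost h (y / A)) + c * |y - A * s|) *
              gaussianPDFReal 0 v (y - A * s) := by
              have := gaussianPDFReal_nonneg 0 v (y - A * s)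
              gcongr
              linarith
          _ = _ := by rw [Real.exp_add]; ring
      · exact Eventually.of_forall fun s => mul_nonneg (Real.exp_pos _).le
          (mul_nonneg (gaussianPDFReal_nonneg 0 v _) (Real.exp_pos _).le)
    rw [h1]
    calc _ ≤ Real.exp (-(μ * fillCost h (y / A))) * (M / A) / (gainMass h μ * expMass μ) := by
          gcongr
      _ = _ := by rw [← div_div]; ring
  have hri : Integrable (fun p : (Fin n → ℝ) × ℝ =>
      μ * fillCost h (((∑ k, h k * p.1 k) + p.2) / A)) (P.prod (gaussianReal 0 v)) := by
    refine Integrable.of_bound (C := μ * n) (Measurable.aestronglyMeasurable (by fun_prop))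
      (Eventually.of_forall fun p => ?_)
    rw [Real.norm_of_nonneg (mul_nonneg hμ.le (fillCost_nonneg _ _))]
    gcongr
    refine (Finset.sum_le_sum fun k _ => (fillVec_mem_Icc h _ k).2).trans ?_
    simp
  have hfb : Integrable (fun x : Fin n → ℝ => μ * fillCost h ((∑ k, h k * x k) / A)) P := by
    refine Integrable.of_bound (C := μ * n) (Measurable.aestronglyMeasurable (by fun_prop))
      (Eventually.of_forall fun p => ?_)
    rw [Real.norm_of_nonneg (mul_nonneg hμ.le (fillCost_nonneg _ _))]
    gcongr
    refine (Finset.sum_le_sum fun k _ => (fillVec_mem_Icc h _ k).2).trans ?_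
    simp
  have hPfill : ∫ x, μ * fillCost h ((∑ k, h k * x k) / A) ∂P =
      μ * (expMean μ + gainMean h μ) := by
    rw [integral_const_mul, hPdef, integral_map hX.aemeasurable
      (Measurable.aestronglyMeasurable (by fun_prop)), ← integral_fillCost_stairMeasure hpos hμ]
    congr 1
    refine integral_congr_ae ?_
    filter_upwards [ae_stairMeasure h μ] with s hs
    rw [hux s hs, mul_div_cancel_left₀ _ hA.ne']
  have g1 : Integrable (fun p : (Fin n → ℝ) × ℝ => μ * fillCost h ((∑ k, h k * p.1 k) / A))
      (P.prod (gaussianReal 0 v)) := hfb.comp_fst _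
  have g2 : Integrable (fun p : (Fin n → ℝ) × ℝ => c * |p.2|) (P.prod (gaussianReal 0 v)) :=
    ((integrable_abs_gaussianReal v).const_mul c).comp_snd P
  have hrint : μ * (expMean μ + gainMean h μ) - c * ∫ z, |z| ∂(gaussianReal 0 v) ≤
      ∫ p, μ * fillCost h (((∑ k, h k * p.1 k) + p.2) / A) ∂(P.prod (gaussianReal 0 v)) := by
    refine le_trans (le_of_eq ?_) (integral_mono (g1.sub g2) hri fun p => ?_)
    · rw [integral_sub' g1 g2,
        integral_fun_fst (μ := P) (ν := gaussianReal 0 v)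
          (fun x => μ * fillCost h ((∑ k, h k * x k) / A)),
        integral_fun_snd (μ := P) (ν := gaussianReal 0 v) (fun z => c * |z|)]
      simp only [probReal_univ, one_smul]
      rw [hPfill, integral_const_mul]
    · have h1 := hlip (∑ k, h k * p.1 k) ((∑ k, h k * p.1 k) + p.2)
      rwa [sub_add_cancel_left, abs_neg] at h1
  have key := le_neg_integral_log_outputDensity (r := fun y => μ * fillCost h (y / A))
    hu hv hB hri (div_pos hM0 (mul_pos hA hZ)) hdens
  have hmi := mutualInfo_shear (P := P) hu hv hB
  rw [misoJoint, hmi, EReal.coe_le_coe_iff]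
  linarith

end Staircase

theorem one_sub_log_sub_eq {μ : ℝ} (hμ : 0 < μ) :
    1 - Real.log (μ / (1 - Real.exp (-μ))) - μ * Real.exp (-μ) / (1 - Real.exp (-μ)) =
      Real.log (expMass μ) + μ * expMean μ := by
  have h1 := one_sub_exp_neg_pos hμ
  have h2 : μ * expMean μ = 1 - μ * Real.exp (-μ) / (1 - Real.exp (-μ)) := by
    rw [expMean]
    field_simp
  have h3 : expMass μ = (μ / (1 - Real.exp (-μ)))⁻¹ := (inv_div _ _).symm
  rw [h2, h3, Real.log_inv]
  ring

section GeometricLaw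

variable {n : ℕ} {h : Fin n → ℝ}

theorem sum_mul_pow_succ (h : Fin n → ℝ) {a : ℝ} (ha : 0 < a) :
    ∑ j : Fin n, h j * a ^ (j.val + 1) = a * gainMass h (-Real.log a) := by
  rw [gainMass, Finset.mul_sum]
  refine Finset.sum_congr rfl fun j _ => ?_
  rw [neg_mul, neg_neg, mul_comm (Real.log a), Real.exp_nat_mul, Real.exp_log ha]
  ring

theorem sum_succ_mul_pow_div_eq [NeZero n] (hpos : ∀ k, 0 < h k) {a : ℝ} (ha : 0 < a) :
    (∑ k : Fin n, h k * ((k.val : ℝ) + 1) * a ^ (k.val + 1)) /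
      (∑ j : Fin n, h j * a ^ (j.val + 1)) = gainMean h (-Real.log a) + 1 := by
  have hG := gainMass_pos hpos (-Real.log a)
  have h1 : ∑ k : Fin n, h k * ((k.val : ℝ) + 1) * a ^ (k.val + 1) =
      a * (∑ k : Fin n, h k * k.val * Real.exp (-(-Real.log a * k.val))) +
        a * gainMass h (-Real.log a) := by
    rw [← sum_mul_pow_succ h ha, Finset.mul_sum, ← Finset.sum_add_distrib]
    refine Finset.sum_congr rfl fun j _ => ?_
    rw [neg_mul, neg_neg, mul_comm (Real.log a), Real.exp_nat_mul, Real.exp_log ha]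
    ring
  rw [h1, sum_mul_pow_succ h ha, gainMean, ← mul_add, mul_div_mul_left _ _ ha.ne', add_div,
    div_self hG.ne']

theorem sum_mul_log_eq [NeZero n] (hpos : ∀ k, 0 < h k) {a : ℝ} (ha : 0 < a) {p : Fin n → ℝ}
    (hp : ∀ k, p k = h k * a ^ (k.val + 1) / ∑ j : Fin n, h j * a ^ (j.val + 1)) :
    ∑ k, p k * Real.log (p k * sCum h n / h k) =
      Real.log (sCum h n) -
        (Real.log (gainMass h (-Real.log a)) + -Real.log a * gainMean h (-Real.log a)) := by
  have hG := gainMass_pos hpos (-Real.log a)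
  have hS : 0 < sCum h n := by
    rw [sCum_self]
    exact Finset.sum_pos (fun k _ => hpos k) Finset.univ_nonempty
  set θ := -Real.log a with hθ
  have hp' : ∀ k : Fin n, p k = h k * Real.exp (-(θ * k.val)) / gainMass h θ := fun k => by
    rw [hp, sum_mul_pow_succ h ha, hθ, neg_mul, neg_neg, mul_comm (Real.log a), Real.exp_nat_mul,
      Real.exp_log ha, pow_succ']
    field_simp
  have hlog : ∀ k : Fin n, Real.log (p k * sCum h n / h k) =
      -(θ * k.val) + (Real.log (sCum h n) - Real.log (gainMass h θ)) := fun k => by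
    have hk := hpos k
    have h1 : p k * sCum h n / h k =
        Real.exp (-(θ * k.val)) * (sCum h n / gainMass h θ) := by
      rw [hp']
      field_simp
    rw [h1, Real.log_mul (Real.exp_pos _).ne' (div_pos hS hG).ne', Real.log_exp,
      Real.log_div hS.ne' hG.ne']
  have hsum : ∑ k, p k = 1 := by
    simp_rw [hp']
    rw [← Finset.sum_div]
    exact div_self hG.ne'
  have hmean : ∑ k, p k * k.val = gainMean h θ := by
    rw [gainMean, Finset.sum_div]
    refine Finset.sum_congr rfl fun k _ => ?_
    rw [hp']
    ring
  calc ∑ k, p k * Real.log (p k * sCum h n / h k) =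
      ∑ k : Fin n, (-θ * (p k * k.val) +
        p k * (Real.log (sCum h n) - Real.log (gainMass h θ))) :=
        Finset.sum_congr rfl fun k _ => by rw [hlog]; ring
    _ = _ := by
      rw [Finset.sum_add_distrib, ← Finset.mul_sum, ← Finset.sum_mul, hsum, hmean]
      ring

end GeometricLaw

theorem tendsto_integral_exp_div_mul_abs (v : ℝ≥0) {c : ℝ} (hc : 0 ≤ c) :
    Tendsto (fun A : ℝ => ∫ z, Real.exp (c / A * |z|) ∂(gaussianReal 0 v)) atTop (nhds 1) := by
  have h1 : (1 : ℝ) = ∫ _, (1 : ℝ) ∂(gaussianReal 0 v) := by simp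
  rw [h1]
  refine tendsto_integral_filter_of_dominated_convergence (fun z => Real.exp (c * |z|))
    (Eventually.of_forall fun A => Measurable.aestronglyMeasurable (by fun_prop)) ?_
    (integrable_exp_mul_abs_gaussianReal v c) (Eventually.of_forall fun z => ?_)
  · filter_upwards [eventually_ge_atTop 1] with A hA
    refine Eventually.of_forall fun z => ?_
    rw [Real.norm_of_nonneg (Real.exp_pos _).le]
    gcongr
    exact div_le_self hc hA
  · have h2 : Tendsto (fun A : ℝ => c / A * |z|) atTop (nhds (0 * |z|)) :=
      (tendsto_const_nhds.div_atTop tendsto_id).mul_const _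
    simpa [Function.comp_def] using (Real.continuous_exp.tendsto _).comp h2

theorem tendsto_misoCapacity_sub_log {n : ℕ} [NeZero n] {h : Fin n → ℝ}
    (hord : ∀ i j : Fin n, i ≤ j → h j ≤ h i) (hpos : ∀ k, 0 < h k) {v : ℝ≥0} (hv : 0 < v)
    {α μ : ℝ} (hμ : 0 < μ) (hα : expMean μ + gainMean h μ = α) :
    Tendsto (fun A : ℝ => misoCapacity h v A (α * A) - ((Real.log A : ℝ) : EReal)) atTop
      (nhds ((-(1 / 2 * Real.log (2 * π * Real.exp 1 * v)) +
        (μ * α + Real.log (gainMass h μ * expMass μ)) : ℝ) : EReal)) := by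
  set K := -(1 / 2 * Real.log (2 * π * Real.exp 1 * v))
  set L := ∑ k, 1 / h k
  set W := ∫ z, |z| ∂(gaussianReal 0 v)
  set Z := gainMass h μ * expMass μ
  have hZ : 0 < Z := mul_pos (gainMass_pos hpos μ) (expMass_pos hμ)
  have hL0 : 0 ≤ L := Finset.sum_nonneg fun k _ => (one_div_pos.2 (hpos k)).le
  have hdiv : Tendsto (fun A : ℝ => μ * L / A) atTop (nhds 0) :=
    tendsto_const_nhds.div_atTop tendsto_id
  have hlo : Tendsto (fun A : ℝ => K + (μ * α - μ * L / A * W -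
      (Real.log (∫ z, Real.exp (μ * L / A * |z|) ∂(gaussianReal 0 v)) - Real.log Z))) atTop
      (nhds (K + (μ * α + Real.log Z))) := by
    have h1 := (tendsto_integral_exp_div_mul_abs v (mul_nonneg hμ.le hL0)).log one_ne_zero
    have h2 := ((tendsto_const_nhds (x := μ * α)).sub (hdiv.mul_const W)).sub
      (h1.sub_const (Real.log Z))
    convert h2.const_add K using 2
    simp
  have hhi : Tendsto (fun A : ℝ => K + (μ * α + (μ * L / A + 1 / √A) * W +
      Real.log (Z + 2 / √A))) atTop (nhds (K + (μ * α + Real.log Z))) := by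
    have h1 : Tendsto (fun A : ℝ => 1 / √A) atTop (nhds 0) :=
      tendsto_const_nhds.div_atTop tendsto_sqrt_atTop
    have h2 : Tendsto (fun A : ℝ => 2 / √A) atTop (nhds 0) :=
      tendsto_const_nhds.div_atTop tendsto_sqrt_atTop
    have h3 := (h2.const_add Z).log (by simpa using hZ.ne')
    have h4 := (((hdiv.add h1).mul_const W).const_add (μ * α)).add h3
    convert h4.const_add K using 2
    simp
  refine tendsto_of_tendsto_of_tendsto_of_le_of_le'
    ((continuous_coe_real_ereal.tendsto _).comp hlo)
    ((continuous_coe_real_ereal.tendsto _).comp hhi) ?_ ?_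
  · filter_upwards [eventually_gt_atTop 0] with A hA
    have hM : 0 < ∫ z, Real.exp (μ * L / A * |z|) ∂(gaussianReal 0 v) :=
      integral_exp_pos (integrable_exp_mul_abs_gaussianReal v _)
    have h1 := le_misoCapacity hpos hv hA hμ
    rw [hα] at h1
    refine le_trans (le_of_eq ?_) (EReal.sub_le_sub h1 le_rfl)
    rw [← EReal.coe_sub, Real.log_div hM.ne' (mul_pos hA hZ).ne', Real.log_mul hA.ne' hZ.ne']
    simp only [Function.comp_apply]
    congr 1
    ring
  · filter_upwards [eventually_gt_atTop 0] with A hA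
    have hb := Real.sqrt_pos.2 hA
    have h1 : misoCapacity h v A (α * A) ≤ ((K + (μ * α + (μ * L + √A) / A * W +
        Real.log (A * (Z + 2 / √A))) : ℝ) : EReal) := by
      refine iSup₂_le fun P hP => ?_
      have := hP.1
      exact mutualInfo_misoJoint_le hord hpos hv hA hμ hb hP.2.1 hP.2.2
    refine (EReal.sub_le_sub h1 le_rfl).trans (le_of_eq ?_)
    rw [← EReal.coe_sub, Real.log_mul hA.ne' (by positivity), add_div, Real.sqrt_div_self']
    simp only [Function.comp_apply]
    congr 1
    ring

theorem miso_capacity_high_snr_below_threshold (n : ℕ) (hn : 2 ≤ n) (h : Fin n → ℝ)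
    (hord : ∀ i j : Fin n, i ≤ j → h j ≤ h i) (hpos : ∀ k, 0 < h k)
    (v : ℝ≥0) (hv : 0 < v)
    (α : ℝ) (hα0 : 0 < α) (hαth : α < alphaTh h)
    (μf af : ℝ → ℝ)
    (hμf : ∀ l ∈ Set.Ioo (max 0 (1 / 2 + α - alphaTh h)) (min (1 / 2) α),
      0 < μf l ∧ 1 / μf l - Real.exp (-μf l) / (1 - Real.exp (-μf l)) = l)
    (haf : ∀ l ∈ Set.Ioo (max 0 (1 / 2 + α - alphaTh h)) (min (1 / 2) α),
      0 < af l ∧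
        (∑ k : Fin n, h k * ((k.val : ℝ) + 1) * af l ^ (k.val + 1)) /
            (∑ j : Fin n, h j * af l ^ (j.val + 1)) = α - l + 1)
    (p : ℝ → Fin n → ℝ)
    (hp : ∀ l k, p l k = h k * af l ^ (k.val + 1) /
      ∑ j : Fin n, h j * af l ^ (j.val + 1))
    (ν : ℝ)
    (hν : ν = sSup ((fun l =>
        1 - Real.log (μf l / (1 - Real.exp (-μf l)))
          - μf l * Real.exp (-μf l) / (1 - Real.exp (-μf l))
          - ∑ k : Fin n, p l k * Real.log (p l k * sCum h n / h k)) ''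
      Set.Ioo (max 0 (1 / 2 + α - alphaTh h)) (min (1 / 2) α))) :
    Tendsto (fun A : ℝ => misoCapacity h v A (α * A) - ((Real.log A : ℝ) : EReal))
      atTop
      (nhds ((1 / 2 * Real.log ((sCum h n) ^ 2 / (2 * π * Real.exp 1 * (v : ℝ))) + ν : ℝ) : EReal)) := by
  have : NeZero n := ⟨by omega⟩
  obtain ⟨μ, hμ, hμα⟩ := exists_expMean_add_gainMean_eq hn hpos hα0 hαth
  set I := Set.Ioo (max 0 (1 / 2 + α - alphaTh h)) (min (1 / 2) α)
  set f : ℝ → ℝ := fun l => 1 - Real.log (μf l / (1 - Real.exp (-μf l)))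
    - μf l * Real.exp (-μf l) / (1 - Real.exp (-μf l))
    - ∑ k : Fin n, p l k * Real.log (p l k * sCum h n / h k)
  have hf : ∀ l ∈ I, expMean (μf l) = l ∧ gainMean h (-Real.log (af l)) = α - l ∧
      f l = Real.log (expMass (μf l)) + μf l * l + (Real.log (gainMass h (-Real.log (af l))) +
        -Real.log (af l) * (α - l)) - Real.log (sCum h n) := by
    intro l hl
    obtain ⟨h1, h2⟩ := hμf l hl
    obtain ⟨h3, h4⟩ := haf l hl
    rw [sum_succ_mul_pow_div_eq hpos h3] at h4
    have h5 : expMean (μf l) = l := h2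
    have h6 : gainMean h (-Real.log (af l)) = α - l := by linarith
    refine ⟨h5, h6, ?_⟩
    have h7 := sum_mul_log_eq hpos h3 (hp l)
    have h8 := one_sub_log_sub_eq h1
    rw [h6] at h7
    rw [h5] at h8
    simp only [f]
    rw [h7, h8]
    ring
  set c := Real.log (expMass μ) + Real.log (gainMass h μ) + μ * α - Real.log (sCum h n) with hc
  have hl : expMean μ ∈ I := by
    have h1 := expMean_pos hμ
    have h2 := expMean_lt_half hμ
    have h3 := gainMean_pos hn hpos μ
    have h4 := gainMean_lt_gainMean_zero hn hpos hμ
    refine ⟨max_lt h1 ?_, lt_min h2 (by linarith)⟩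
    rw [alphaTh_eq]
    linarith
  have hgreatest : IsGreatest (f '' I) c := by
    refine ⟨⟨expMean μ, hl, ?_⟩, ?_⟩
    · obtain ⟨h1, h2, h3⟩ := hf _ hl
      have h4 : gainMean h μ = α - expMean μ := by linarith
      have h5 := log_expMass_add_le hμ (hμf _ hl).1
      have h6 := log_expMass_add_le (hμf _ hl).1 hμ
      have h7 := log_gainMass_add_le hpos μ (-Real.log (af (expMean μ)))
      have h8 := log_gainMass_add_le hpos (-Real.log (af (expMean μ))) μ
      rw [h1] at h5
      rw [h2] at h7
      rw [h4] at h8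
      rw [h3, hc]
      linarith
    · rintro _ ⟨l, hl, rfl⟩
      obtain ⟨h1, h2, h3⟩ := hf _ hl
      have h5 := log_expMass_add_le hμ (hμf _ hl).1
      have h7 := log_gainMass_add_le hpos μ (-Real.log (af l))
      rw [h1] at h5
      rw [h2] at h7
      rw [h3, hc]
      linarith
  have hνc : ν = c := hν.trans hgreatest.csSup_eq
  have hS : 0 < sCum h n := by
    rw [sCum_self]
    exact Finset.sum_pos (fun k _ => hpos k) Finset.univ_nonempty
  have hv' : (0 : ℝ) < v := hv
  convert tendsto_misoCapacity_sub_log hord hpos hv hμ hμα using 3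
  rw [hνc, hc, Real.log_div (by positivity) (by positivity), Real.log_pow,
    Real.log_mul (gainMass_pos hpos μ).ne' (expMass_pos hμ).ne']
  push_cast
  ring
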